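/- arXiv:1201.0989 — 2 statements merged into one kernel-verified Lean document; each statement's English description precedes it below -/
import Mathlib

section
/- Let X be a strongly locally finite, compactly indecomposable CAT(0) cube complex. Then for every finite subgraph Λ of the crossing graph Δ(X), the full subgraph of Δ(X) on the vertices not in Λ is connected; in particular, Δ(X) itself is connected. -/
/-!
Combinatorial model of a CAT(0) cube complex via Sageev duality.

`V` is the set of 0-cubes, `H` the set of hyperplanes, and `side h x : Bool`
records which halfspace of the hyperplane `h` contains the 0-cube `x`.
The axioms say exactly that `V` is the set of consistent orientations of the
hyperplanes, each differing from a fixed one on finitely many hyperplanes;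
this is precisely the combinatorial data of (the 0-skeleton of) a CAT(0) cube
complex, together with its hyperplane structure.
-/
structure CCC where
  V : Type
  H : Type
  side : H → V → Bool
  nonempty_V : Nonempty V
  vertex_ext : ∀ x y : V, (∀ h, side h x = side h y) → x = y
  sep_finite : ∀ x y : V, {h : H | side h x ≠ side h y}.Finite
  halfspace_nonempty : ∀ h b, ∃ x, side h x = b
  hyp_inj : ∀ h h' : H, (∀ x, side h x = side h' x) → h = h'
  hyp_inj' : ∀ h h' : H, (∀ x, side h x = !(side h' x)) → h = h'
  realize : ∀ (o : H → Bool) (x : V),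
    (∀ h h', ∃ y, side h y = o h ∧ side h' y = o h') →
    {h : H | o h ≠ side h x}.Finite →
    ∃ y, ∀ h, side h y = o h

namespace CCC

variable (X : CCC)

/-- The combinatorial (1-skeleton) distance between 0-cubes: the number of
separating hyperplanes. -/
noncomputable def dist (x y : X.V) : ℕ := (X.sep_finite x y).toFinset.card

/-- Two 0-cubes are adjacent (joined by a 1-cube) iff exactly one hyperplane
separates them. -/
def Adj (x y : X.V) : Prop :=
  ∃ h, X.side h x ≠ X.side h y ∧ ∀ h', X.side h' x ≠ X.side h' y → h' = h

/-- Two hyperplanes cross iff all four quarter-spaces are nonempty. -/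
def Crosses (h h' : X.H) : Prop :=
  ∀ b b' : Bool, ∃ x, X.side h x = b ∧ X.side h' x = b'

/-- The hyperplane `h'` lies in the halfspace `b` of the hyperplane `h`. -/
def InHalf (h' h : X.H) (b : Bool) : Prop :=
  h' ≠ h ∧ ∃ c : Bool, ∀ x, X.side h x = !b → X.side h' x = c

/-- `h` separates the hyperplanes `h₁` and `h₂`. -/
def SepH (h h₁ h₂ : X.H) : Prop :=
  ∃ b : Bool, X.InHalf h₁ h b ∧ X.InHalf h₂ h (!b)

/-- Two distinct hyperplanes contact iff no third hyperplane separates them. -/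
def Contact (h h' : X.H) : Prop := h ≠ h' ∧ ¬ ∃ h'', X.SepH h'' h h'

/-- A facing triple: three distinct hyperplanes, each having a halfspace
containing the other two. -/
def FacingTriple (h₁ h₂ h₃ : X.H) : Prop :=
  h₁ ≠ h₂ ∧ h₁ ≠ h₃ ∧ h₂ ≠ h₃ ∧
  ∃ b₁ b₂ b₃ : Bool,
    X.InHalf h₂ h₁ b₁ ∧ X.InHalf h₃ h₁ b₁ ∧
    X.InHalf h₁ h₂ b₂ ∧ X.InHalf h₃ h₂ b₂ ∧
    X.InHalf h₁ h₃ b₃ ∧ X.InHalf h₂ h₃ b₃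

/-- A set of hyperplanes is inseparable if every hyperplane separating two of
its members belongs to it. -/
def Inseparable (U : Set X.H) : Prop :=
  ∀ u ∈ U, ∀ u' ∈ U, ∀ h, X.SepH h u u' → h ∈ U

/-- A set of hyperplanes is unidirectional if each member has a halfspace
containing only finitely many members. -/
def Unidirectional (U : Set X.H) : Prop :=
  ∀ u ∈ U, ∃ b : Bool, {h | h ∈ U ∧ X.InHalf h u b}.Finite

def NoFacingTriple (U : Set X.H) : Prop :=
  ∀ h₁ ∈ U, ∀ h₂ ∈ U, ∀ h₃ ∈ U, ¬ X.FacingTriple h₁ h₂ h₃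

/-- A unidirectional boundary set (UBS). -/
def IsUBS (U : Set X.H) : Prop :=
  U.Infinite ∧ X.Inseparable U ∧ X.Unidirectional U ∧ X.NoFacingTriple U

/-- Almost-equivalence: finite symmetric difference. -/
def AlmostEq (U U' : Set X.H) : Prop := (symmDiff U U').Finite

/-- A minimal UBS. -/
def MinUBS (U : Set X.H) : Prop :=
  X.IsUBS U ∧ ∀ U' ⊆ U, X.IsUBS U' → X.AlmostEq U U'

/-- The simplex (= almost-equivalence class of UBSs) represented by `U` is a
face of the simplex represented by `V`. -/
def FaceOf (U V : Set X.H) : Prop :=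
  ∃ U' V', X.IsUBS U' ∧ X.IsUBS V' ∧ X.AlmostEq U U' ∧ X.AlmostEq V V' ∧ U' ⊆ V'

/-- `U` decomposes, up to almost-equivalence, into `k` pairwise disjoint
minimal UBSs; i.e. the class of `U` is a `(k-1)`-simplex of `∂X`. -/
def HasDim (U : Set X.H) (k : ℕ) : Prop :=
  ∃ 𝒰 : Fin k → Set X.H, (∀ i, X.MinUBS (𝒰 i)) ∧
    (∀ i j, i ≠ j → Disjoint (𝒰 i) (𝒰 j)) ∧ X.AlmostEq U (⋃ i, 𝒰 i)

/-- No infinite family of pairwise-crossing hyperplanes. -/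
def NoInfiniteCrossing : Prop :=
  ∀ S : Set X.H, (∀ h ∈ S, ∀ h' ∈ S, h ≠ h' → X.Crosses h h') → S.Finite

def LocallyFinite : Prop := ∀ x : X.V, {y | X.Adj x y}.Finite

/-- A combinatorial geodesic ray (parameterized by its vertices). -/
def IsGeodesicRay (γ : ℕ → X.V) : Prop :=
  ∀ m n : ℕ, m ≤ n → X.dist (γ m) (γ n) = n - m

/-- A bi-infinite combinatorial geodesic. -/
def IsGeodesicLine (α : ℤ → X.V) : Prop :=
  ∀ m n : ℤ, m ≤ n → (X.dist (α m) (α n) : ℤ) = n - m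

/-- A combinatorial geodesic segment of length `n`. -/
def IsGeodSeg (c : ℕ → X.V) (n : ℕ) : Prop :=
  ∀ i j : ℕ, i ≤ j → j ≤ n → X.dist (c i) (c j) = j - i

/-- The set of hyperplanes crossing (dual to the 1-cubes of) the path `γ`. -/
def WSet (γ : ℕ → X.V) : Set X.H :=
  {h | ∃ n : ℕ, X.side h (γ n) ≠ X.side h (γ (n+1))}

/-- The 0-cubes of the carrier `N(h)` of the hyperplane `h`. -/
def carrier (h : X.H) : Set X.V :=
  {x | ∃ y, X.Adj x y ∧ X.side h x ≠ X.side h y}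

/-- An essential hyperplane: each halfspace contains 0-cubes arbitrarily far
from the carrier. -/
def EssentialHyp (h : X.H) : Prop :=
  ∀ b : Bool, ∀ n : ℕ, ∃ x, X.side h x = b ∧ ∀ y ∈ X.carrier h, n ≤ X.dist x y

/-- Combinatorial convexity of a set of 0-cubes (the 0-skeleton of a convex
subcomplex). -/
def IsConvexSet (S : Set X.V) : Prop :=
  ∀ x ∈ S, ∀ y ∈ S, ∀ z, X.dist x z + X.dist z y = X.dist x y → z ∈ S

/-- `x` and `y` are joined by a combinatorial path avoiding `S`. -/
def ReachAvoid (S : Set X.V) (x y : X.V) : Prop :=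
  ∃ (n : ℕ) (c : ℕ → X.V), c 0 = x ∧ c n = y ∧
    (∀ i < n, X.Adj (c i) (c (i+1))) ∧ ∀ i ≤ n, c i ∉ S

/-- No compact (finite) convex subcomplex disconnects `X`. -/
def CompactlyIndecomposable : Prop :=
  ∀ K : Set X.V, K.Finite → X.IsConvexSet K →
    ∀ x y : X.V, x ∉ K → y ∉ K → X.ReachAvoid K x y

/-- `γ` bounds an eighth-flat: some eighth-flat (the subcomplex of the standard
tiling of `[0,∞)²` below the graph of an unbounded nondecreasing function)
embeds isometrically and cubically in `X` with image containing `γ`. -/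
def BoundsEighthFlat (γ : ℕ → X.V) : Prop :=
  ∃ g : ℕ → ℕ, Monotone g ∧ (∀ N : ℕ, ∃ m, N ≤ g m) ∧
    ∃ e : {p : ℕ × ℕ // p.2 ≤ g p.1} → X.V,
      (∀ p q, X.dist (e p) (e q) = Nat.dist p.1.1 q.1.1 + Nat.dist p.1.2 q.1.2) ∧
      ∀ n : ℕ, ∃ p, e p = γ n

/-- An edge-chain in the contact graph. -/
def CChain (c : ℕ → X.H) (n : ℕ) : Prop := ∀ i < n, X.Contact (c i) (c (i+1))

/-- Distance in the contact graph `C(X)` (`⊤` if there is no path). -/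
noncomputable def cdist (h h' : X.H) : ℕ∞ :=
  sInf {e : ℕ∞ | ∃ (n : ℕ) (c : ℕ → X.H), c 0 = h ∧ c n = h' ∧ X.CChain c n ∧ e = n}

/-- An edge-chain in the crossing graph. -/
def XChain (c : ℕ → X.H) (n : ℕ) : Prop := ∀ i < n, X.Crosses (c i) (c (i+1))

/-- Distance in the crossing graph `Δ(X)`. -/
noncomputable def xdist (h h' : X.H) : ℕ∞ :=
  sInf {e : ℕ∞ | ∃ (n : ℕ) (c : ℕ → X.H), c 0 = h ∧ c n = h' ∧ X.XChain c n ∧ e = n}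

/-- Distance in the full subgraph `Λ(γ)` of the contact graph spanned by the
hyperplanes crossing `γ`. -/
noncomputable def ldist (γ : ℕ → X.V) (h h' : X.H) : ℕ∞ :=
  sInf {e : ℕ∞ | ∃ (n : ℕ) (c : ℕ → X.H), c 0 = h ∧ c n = h' ∧
    (∀ i ≤ n, c i ∈ X.WSet γ) ∧ X.CChain c n ∧ e = n}

/-- Two 0-simplices of `∂X` (represented by minimal UBSs) are adjacent in the
1-skeleton of `∂X`. -/
def BAdj (U V : Set X.H) : Prop :=
  X.MinUBS U ∧ X.MinUBS V ∧ ¬ X.AlmostEq U V ∧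
    ∃ W, X.IsUBS W ∧ X.FaceOf U W ∧ X.FaceOf V W

/-- Distance in the 1-skeleton of the simplicial boundary `∂X`, between the
0-simplices represented by the minimal UBSs `U` and `V`. -/
noncomputable def bdist (U V : Set X.H) : ℕ∞ :=
  sInf {e : ℕ∞ | ∃ (n : ℕ) (c : ℕ → Set X.H),
    X.AlmostEq (c 0) U ∧ X.AlmostEq (c n) V ∧ (∀ i ≤ n, X.MinUBS (c i)) ∧
    (∀ i < n, X.BAdj (c i) (c (i+1)) ∨ X.AlmostEq (c i) (c (i+1))) ∧ e = n}

/-- Diameter of the contact graph. -/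
noncomputable def cdiam : ℕ∞ := ⨆ (h : X.H) (h' : X.H), X.cdist h h'

/-- Diameter of the crossing graph. -/
noncomputable def xdiam : ℕ∞ := ⨆ (h : X.H) (h' : X.H), X.xdist h h'

/-- Diameter of the 1-skeleton of the simplicial boundary. -/
noncomputable def bdiam : ℕ∞ :=
  ⨆ (U : Set X.H) (V : Set X.H) (_ : X.MinUBS U) (_ : X.MinUBS V), X.bdist U V

/-- A consistent orientation of the hyperplanes: any two chosen halfspaces
intersect. -/
def Consistent (χ : X.H → Bool) : Prop :=
  ∀ h h', ∃ x, X.side h x = χ h ∧ X.side h' x = χ h'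

/-- The halfspace `b` of `h`, as a set of 0-cubes. -/
def Hs (h : X.H) (b : Bool) : Set X.V := {x | X.side h x = b}

/-- Every simplex of `∂X` is visible, i.e. represented by the set of
hyperplanes crossing some combinatorial geodesic ray. -/
def FullyVisible : Prop :=
  ∀ V, X.IsUBS V → ∃ γ : ℕ → X.V, X.IsGeodesicRay γ ∧ X.AlmostEq (X.WSet γ) V

/-- The halfspace `b` of `h` is shallow: it lies within uniformly bounded
distance of the carrier of `h`. -/
def ShallowHalf (h : X.H) (b : Bool) : Prop :=
  ∃ R : ℕ, ∀ x, X.side h x = b → ∃ y ∈ X.carrier h, X.dist x y ≤ R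

/-- An `r`-avoiding combinatorial path (with respect to the basepoint `x₀`)
of length `n` from `a` to `b`. -/
def AvoidPathLen (x₀ : X.V) (r : ℕ) (a b : X.V) (n : ℕ) : Prop :=
  ∃ c : ℕ → X.V, c 0 = a ∧ c n = b ∧
    (∀ i < n, X.Adj (c i) (c (i+1))) ∧ ∀ i ≤ n, r ≤ X.dist (c i) x₀

/-- Combinatorial geodesic completeness: for every (finite) maximal family of
pairwise-crossing hyperplanes and every choice of halfspaces, the intersection
of the chosen halfspaces contains 0-cubes arbitrarily far from the
intersection of the carriers. -/
def CombGeodComplete : Prop :=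
  ∀ (n : ℕ) (W : Fin n → X.H), Function.Injective W →
    (∀ i j, i ≠ j → X.Crosses (W i) (W j)) →
    (∀ h, ¬ ∀ i, X.Crosses h (W i)) →
    ∀ χ : Fin n → Bool, ∀ R : ℕ,
      ∃ x, (∀ i, X.side (W i) x = χ i) ∧
        ∀ y, (∀ i, y ∈ X.carrier (W i)) → R ≤ X.dist x y

/-- `X` decomposes as a product of two unbounded convex subcomplexes:
equivalently, the hyperplanes split into two parts, each member of one part
crossing each member of the other, both factors being unbounded. -/
def ProductDecomp : Prop :=
  ∃ H₁ H₂ : Set X.H, Disjoint H₁ H₂ ∧ H₁ ∪ H₂ = Set.univ ∧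
    (∀ h₁ ∈ H₁, ∀ h₂ ∈ H₂, X.Crosses h₁ h₂) ∧
    (∀ n : ℕ, ∃ x y : X.V, n ≤ ({h | X.side h x ≠ X.side h y} ∩ H₁).ncard) ∧
    (∀ n : ℕ, ∃ x y : X.V, n ≤ ({h | X.side h x ≠ X.side h y} ∩ H₂).ncard)

/-- `∂X` decomposes as the simplicial join of two disjoint nonempty
subcomplexes: the 0-simplices split into two nonempty parts, any 0-simplex of
one part spanning a 1-simplex with any 0-simplex of the other. -/
def JoinDecomp : Prop :=
  ∃ 𝒜₁ 𝒜₂ : Set (Set X.H),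
    (∀ U ∈ 𝒜₁, X.MinUBS U) ∧ (∀ U ∈ 𝒜₂, X.MinUBS U) ∧
    𝒜₁.Nonempty ∧ 𝒜₂.Nonempty ∧
    (∀ U U', U ∈ 𝒜₁ → X.MinUBS U' → X.AlmostEq U U' → U' ∈ 𝒜₁) ∧
    (∀ U U', U ∈ 𝒜₂ → X.MinUBS U' → X.AlmostEq U U' → U' ∈ 𝒜₂) ∧
    (∀ U, X.MinUBS U → U ∈ 𝒜₁ ∨ U ∈ 𝒜₂) ∧
    (∀ U ∈ 𝒜₁, ∀ V ∈ 𝒜₂, ¬ X.AlmostEq U V) ∧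
    (∀ U ∈ 𝒜₁, ∀ V ∈ 𝒜₂, ∃ W, X.IsUBS W ∧ X.FaceOf U W ∧ X.FaceOf V W)

/-! Relative versions of the hyperplane notions, for a (convex) subcomplex
with 0-cube set `S`; the hyperplanes of the subcomplex are the hyperplanes of
`X` crossing it. -/

/-- `h` crosses the subcomplex with 0-cubes `S`. -/
def CrossesSet (S : Set X.V) (h : X.H) : Prop :=
  ∃ x ∈ S, ∃ y ∈ S, X.side h x ≠ X.side h y

def InHalfOn (S : Set X.V) (h' h : X.H) (b : Bool) : Prop :=
  h' ≠ h ∧ ∃ c : Bool, ∀ x ∈ S, X.side h x = !b → X.side h' x = c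

def SepHOn (S : Set X.V) (h h₁ h₂ : X.H) : Prop :=
  X.CrossesSet S h ∧ ∃ b : Bool, X.InHalfOn S h₁ h b ∧ X.InHalfOn S h₂ h (!b)

def InseparableOn (S : Set X.V) (U : Set X.H) : Prop :=
  ∀ u ∈ U, ∀ u' ∈ U, ∀ h, X.SepHOn S h u u' → h ∈ U

def UnidirectionalOn (S : Set X.V) (U : Set X.H) : Prop :=
  ∀ u ∈ U, ∃ b : Bool, {h | h ∈ U ∧ X.InHalfOn S h u b}.Finite

def NoFacingTripleOn (S : Set X.V) (U : Set X.H) : Prop :=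
  ∀ h₁ ∈ U, ∀ h₂ ∈ U, ∀ h₃ ∈ U, ¬ (h₁ ≠ h₂ ∧ h₁ ≠ h₃ ∧ h₂ ≠ h₃ ∧
    ∃ b₁ b₂ b₃ : Bool,
      X.InHalfOn S h₂ h₁ b₁ ∧ X.InHalfOn S h₃ h₁ b₁ ∧
      X.InHalfOn S h₁ h₂ b₂ ∧ X.InHalfOn S h₃ h₂ b₂ ∧
      X.InHalfOn S h₁ h₃ b₃ ∧ X.InHalfOn S h₂ h₃ b₃)

/-- A UBS of the subcomplex with 0-cube set `S`. -/
def IsUBSOn (S : Set X.V) (U : Set X.H) : Prop :=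
  (∀ h ∈ U, X.CrossesSet S h) ∧ U.Infinite ∧ X.InseparableOn S U ∧
    X.UnidirectionalOn S U ∧ X.NoFacingTripleOn S U

def MinUBSOn (S : Set X.V) (U : Set X.H) : Prop :=
  X.IsUBSOn S U ∧ ∀ U' ⊆ U, X.IsUBSOn S U' → X.AlmostEq U U'

def FaceOfOn (S : Set X.V) (U V : Set X.H) : Prop :=
  ∃ U' V', X.IsUBSOn S U' ∧ X.IsUBSOn S V' ∧ X.AlmostEq U U' ∧ X.AlmostEq V V' ∧ U' ⊆ V'

def HasDimOn (S : Set X.V) (U : Set X.H) (k : ℕ) : Prop :=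
  ∃ 𝒰 : Fin k → Set X.H, (∀ i, X.MinUBSOn S (𝒰 i)) ∧
    (∀ i j, i ≠ j → Disjoint (𝒰 i) (𝒰 j)) ∧ X.AlmostEq U (⋃ i, 𝒰 i)

end CCC

namespace CCC

variable {X : CCC}

/-- An edge-path in the 1-skeleton carries along any property of its initial vertex that passes
to adjacent vertices outside `S`. -/
lemma ReachAvoid.induct {S : Set X.V} {x y : X.V} (hr : X.ReachAvoid S x y) {p : X.V → Prop}
    (hx : p x) (step : ∀ a b, X.Adj a b → b ∉ S → p a → p b) : p y := by
  obtain ⟨n, c, rfl, rfl, hadj, hav⟩ := hr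
  have key : ∀ i ≤ n, p (c i) := by
    intro i
    induction i with
    | zero => exact fun _ => hx
    | succ i ih => exact fun hi => step _ _ (hadj i hi) (hav _ hi) (ih (by omega))
  exact key n le_rfl

/-- A hyperplane taking the same value at both ends of a geodesic is constant along it. -/
lemma side_eq_of_dist_add {x y z : X.V} (hd : X.dist x z + X.dist z y = X.dist x y) {h : X.H}
    (hxy : X.side h x = X.side h y) : X.side h z = X.side h x := by
  classical
  by_contra hne
  have hsub : (X.sep_finite x y).toFinset ⊆
      ((X.sep_finite x z).toFinset ∪ (X.sep_finite z y).toFinset).erase h := by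
    intro k hk
    simp only [Finset.mem_erase, Finset.mem_union, Set.Finite.mem_toFinset,
      Set.mem_ofPred_eq] at hk ⊢
    grind
  have hmem : h ∈ (X.sep_finite x z).toFinset ∩ (X.sep_finite z y).toFinset := by
    simp only [Finset.mem_inter, Set.Finite.mem_toFinset, Set.mem_ofPred_eq]
    grind
  have h1 := Finset.card_le_card hsub
  have h2 := Finset.card_union_add_card_inter (X.sep_finite x z).toFinset
    (X.sep_finite z y).toFinset
  have h3 := Finset.card_pos.mpr ⟨h, hmem⟩
  have h4 := Finset.card_erase_le
    (s := (X.sep_finite x z).toFinset ∪ (X.sep_finite z y).toFinset) (a := h)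
  simp only [dist] at hd
  omega

/-- The 0-cubes that no hyperplane outside `L` separates from `v`. -/
def fiber (X : CCC) (L : Set X.H) (v : X.V) : Set X.V :=
  {x | ∀ h, h ∉ L → X.side h x = X.side h v}

lemma fiber_finite {L : Set X.H} (hL : L.Finite) (v : X.V) : (X.fiber L v).Finite := by
  have := hL.to_subtype
  refine Set.Finite.of_injOn (f := fun x (h : L) => X.side h x) (t := Set.univ)
    (Set.mapsTo_univ _ _) ?_ Set.finite_univ
  intro x hx y hy hxy
  refine X.vertex_ext x y fun h => ?_
  by_cases hh : h ∈ L
  · exact congrFun hxy ⟨h, hh⟩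
  · rw [hx h hh, hy h hh]

lemma fiber_convex (L : Set X.H) (v : X.V) : X.IsConvexSet (X.fiber L v) := by
  intro x hx y hy z hz h hh
  rw [side_eq_of_dist_add hz ((hx h hh).trans (hy h hh).symm), hx h hh]

lemma CompactlyIndecomposable.reachAvoid_empty (hci : X.CompactlyIndecomposable) (x y : X.V) :
    X.ReachAvoid ∅ x y :=
  hci ∅ Set.finite_empty (fun _ hx => hx.elim) x y (Set.notMem_empty x) (Set.notMem_empty y)

lemma CompactlyIndecomposable.exists_dual_edge (hci : X.CompactlyIndecomposable) (h : X.H) :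
    ∃ x y, X.side h x ≠ X.side h y ∧ ∀ k, X.side k x ≠ X.side k y → k = h := by
  obtain ⟨x, hx⟩ := X.halfspace_nonempty h true
  obtain ⟨y, hy⟩ := X.halfspace_nonempty h false
  by_contra! hcon
  have := (hci.reachAvoid_empty x y).induct (p := fun z => X.side h z = true) hx (by
    rintro a b ⟨k, hk, hk'⟩ - ha
    by_contra hb
    have hab : X.side h a ≠ X.side h b := by rw [ha]; exact Ne.symm hb
    obtain ⟨l, hl, hlh⟩ := hcon a b hab
    exact hlh ((hk' l hl).trans (hk' h hab).symm))
  simp [hy] at this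

/-- Some hyperplane of `P` is the only hyperplane outside `L` separating `x` from some 0-cube. -/
def Touches (X : CCC) (L P : Set X.H) (x : X.V) : Prop :=
  ∃ w, ∃ k ∈ P, X.side k x ≠ X.side k w ∧ ∀ l ∉ L, X.side l x ≠ X.side l w → l = k

/-- If the hyperplanes outside `L` are split into nonempty parts `P` and `Q`, some 0-cube
touches both parts. -/
lemma CompactlyIndecomposable.exists_touches (hci : X.CompactlyIndecomposable) {L P Q : Set X.H}
    (hPL : Disjoint P L) (hcover : ∀ h ∉ L, h ∈ P ∨ h ∈ Q) (hP : P.Nonempty) (hQ : Q.Nonempty) :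
    ∃ v, X.Touches L P v ∧ X.Touches L Q v := by
  obtain ⟨p, hp⟩ := hP
  obtain ⟨q, hq⟩ := hQ
  obtain ⟨x, x', hx, hx'⟩ := hci.exists_dual_edge p
  obtain ⟨y, y', hy, hy'⟩ := hci.exists_dual_edge q
  by_contra! hcon
  refine hcon y ?_ ⟨y', q, hq, hy, fun l _ => hy' l⟩
  refine (hci.reachAvoid_empty x y).induct ⟨x', p, hp, hx, fun l _ => hx' l⟩ ?_
  rintro a b ⟨m, hm, hm'⟩ - hta
  by_cases hmL : m ∈ L
  · have hside : ∀ l ∉ L, X.side l a = X.side l b := fun l hl => by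
      by_contra hne
      exact hl (hm' l hne ▸ hmL)
    obtain ⟨w, k, hk, hkw, hl⟩ := hta
    exact ⟨w, k, hk, hside k (Set.disjoint_left.mp hPL hk) ▸ hkw,
      fun l hlL h => hl l hlL (hside l hlL ▸ h)⟩
  · rcases hcover m hmL with hmP | hmQ
    · exact ⟨a, m, hmP, hm.symm, fun l _ h => hm' l h.symm⟩
    · exact (hcon a hta ⟨b, m, hmQ, hm, fun l _ => hm' l⟩).elim

/-- Some hyperplane of `P` separates `v` from `x`, and every hyperplane of `Q` separating `v`
from `x` lies behind it. -/
def FirstIn (X : CCC) (P Q : Set X.H) (v x : X.V) : Prop :=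
  ∃ m ∈ P, X.side m v ≠ X.side m x ∧ ∀ q ∈ Q, X.side q v ≠ X.side q x →
    ∀ z, X.side q v ≠ X.side q z → X.side m v ≠ X.side m z

lemma FirstIn.of_adj {L P Q : Set X.H} (hcover : ∀ h ∉ L, h ∈ P ∨ h ∈ Q)
    (hcross : ∀ p ∈ P, ∀ q ∈ Q, ¬ X.Crosses p q) {v x y : X.V} (hxy : X.Adj x y)
    (hy : y ∉ X.fiber L v) (hx : X.FirstIn P Q v x) : X.FirstIn P Q v y := by
  obtain ⟨k, -, hk⟩ := hxy
  obtain ⟨m, hm, hmx, hmq⟩ := hx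
  by_cases hmy : X.side m v = X.side m y
  · have hmk : m = k := hk m fun h => hmx (hmy.trans h.symm)
    have hQ : ∀ q ∈ Q, X.side q v = X.side q y := by
      intro q hq
      by_contra hqy
      by_cases hqx : X.side q v = X.side q x
      · have hqm : q = m := (hk q fun h => hqy (hqx.trans h)).trans hmk.symm
        exact hqy (hqm ▸ hmy)
      · exact hmq q hq hqx y hqy hmy
    simp only [fiber, Set.mem_ofPred_eq, not_forall] at hy
    obtain ⟨l, hl, hly⟩ := hy
    rcases hcover l hl with hlP | hlQ
    · exact ⟨l, hlP, Ne.symm hly, fun q hq h => (h (hQ q hq)).elim⟩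
    · exact (hly (hQ l hlQ).symm).elim
  · refine ⟨m, hm, hmy, fun q hq hqy => ?_⟩
    by_cases hqx : X.side q v = X.side q x
    · intro z hqz hmz
      have bool_eq : ∀ {a b c : Bool}, a ≠ b → c ≠ a → b = c := by decide
      refine hcross m hm q hq fun b b' => ?_
      by_cases hb : b = X.side m v <;> by_cases hb' : b' = X.side q v
      · exact ⟨v, hb.symm, hb'.symm⟩
      · exact ⟨z, (hb.trans hmz).symm, bool_eq hqz hb'⟩
      · exact ⟨x, bool_eq hmx hb, (hb'.trans hqx).symm⟩
      · exact ⟨y, bool_eq hmy hb, bool_eq hqy hb'⟩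
    · exact hmq q hq hqx

/-- Hyperplanes of a compactly indecomposable complex lying outside a finite set `L` cannot be
split into two nonempty parts without crossings between them. -/
lemma CompactlyIndecomposable.exists_crosses (hci : X.CompactlyIndecomposable)
    {L P Q : Set X.H} (hL : L.Finite) (hcover : ∀ h ∉ L, h ∈ P ∨ h ∈ Q) (hPL : Disjoint P L)
    (hQL : Disjoint Q L) (hPQ : Disjoint P Q) (hP : P.Nonempty) (hQ : Q.Nonempty) :
    ∃ p ∈ P, ∃ q ∈ Q, X.Crosses p q := by
  by_contra! hcross
  obtain ⟨v, ⟨x, p, hp, hpx, hx⟩, ⟨y, q, hq, hqy, hy⟩⟩ := hci.exists_touches hPL hcover hP hQ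
  have hpL := Set.disjoint_left.mp hPL
  have hqL := Set.disjoint_left.mp hQL
  have hpq := Set.disjoint_left.mp hPQ
  have hreach := hci _ (fiber_finite hL v) (fiber_convex L v) x y
    (fun h => hpx (h p (hpL hp)).symm) (fun h => hqy (h q (hqL hq)).symm)
  obtain ⟨m, hm, hmy, -⟩ := hreach.induct (p := X.FirstIn P Q v)
    ⟨p, hp, hpx, fun r hr hrx => (hpq hp (hx r (hqL hr) hrx ▸ hr)).elim⟩
    (fun _ _ hab hb ha => ha.of_adj hcover hcross hab hb)
  exact hpq hm (hy m (hpL hm) hmy ▸ hq)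

end CCC

/-- A relation path can be indexed by an initial segment of the natural numbers. -/
lemma Relation.ReflTransGen.exists_seq {α : Type*} {r : α → α → Prop} {a b : α}
    (h : Relation.ReflTransGen r a b) :
    ∃ (n : ℕ) (c : ℕ → α), c 0 = a ∧ c n = b ∧ ∀ i < n, r (c i) (c (i + 1)) := by
  induction h with
  | refl => exact ⟨0, fun _ => a, rfl, rfl, by simp⟩
  | @tail b d _ hbd ih =>
    obtain ⟨n, c, h0, hn, hc⟩ := ih
    refine ⟨n + 1, fun i => if i ≤ n then c i else d, by simpa using h0, by simp, ?_⟩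
    intro i hi
    rcases Nat.lt_succ_iff_lt_or_eq.mp hi with hi | rfl
    · simpa [hi.le, Nat.succ_le_of_lt hi] using hc i hi
    · simpa [hn] using hbd

/-- Lemma 6.7.  In a strongly locally finite, compactly indecomposable CAT(0)
cube complex, removing any finite subgraph from the crossing graph leaves it
connected; in particular the crossing graph is connected. -/
theorem crossing_graph_minus_finite_connected (X : CCC)
    (hlf : X.LocallyFinite) (hnc : X.NoInfiniteCrossing)
    (hci : X.CompactlyIndecomposable) :
    ∀ Λ : Set X.H, Λ.Finite → ∀ h h' : X.H, h ∉ Λ → h' ∉ Λ →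
      ∃ (n : ℕ) (c : ℕ → X.H), c 0 = h ∧ c n = h' ∧
        (∀ i < n, X.Crosses (c i) (c (i + 1))) ∧ ∀ i ≤ n, c i ∉ Λ := by
  intro Λ hΛ h h' hh hh'
  let r : X.H → X.H → Prop := fun a b => X.Crosses a b ∧ b ∉ Λ
  have hreach : Relation.ReflTransGen r h h' := by
    by_contra hcon
    let P : Set X.H := {g | g ∉ Λ ∧ Relation.ReflTransGen r h g}
    let Q : Set X.H := {g | g ∉ Λ ∧ ¬ Relation.ReflTransGen r h g}
    obtain ⟨p, hp, q, hq, hpq⟩ := hci.exists_crosses (P := P) (Q := Q) hΛ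
      (fun g hg => (em (Relation.ReflTransGen r h g)).imp (⟨hg, ·⟩) (⟨hg, ·⟩))
      (Set.disjoint_left.mpr fun _ hg => hg.1) (Set.disjoint_left.mpr fun _ hg => hg.1)
      (Set.disjoint_left.mpr fun _ hg hg' => hg'.2 hg.2)
      ⟨h, hh, .refl⟩ ⟨h', hh', hcon⟩
    exact hq.2 (hp.2.tail ⟨hpq, hq.1⟩)
  obtain ⟨n, c, h0, hn, hc⟩ := hreach.exists_seq
  refine ⟨n, c, h0, hn, fun i hi => (hc i hi).1, fun i hi => ?_⟩
  rcases i with _ | i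
  · rwa [h0]
  · exact (hc i hi).2
end

section
/- Let X be a strongly locally finite CAT(0) cube complex. Then the 1-skeleton of the simplicial boundary ∂X has finite diameter (in the standard graph path-metric, in particular ∂X is connected) if and only if X has weakly uniformly linear divergence, i.e. there exists a constant A such that for every 0-cube x_0 and every pair of combinatorial geodesic rays γ, γ' emanating from x_0 there exists B with div_{γ,γ'}(r) ≤ A r + B for all r ≥ 0. -/
namespace CCC

variable {X : CCC}

/-! ### Orientations that are limits of 0-cubes -/

/-- The hyperplanes on which two orientations differ. -/
def diff (o o' : X.H → Bool) : Set X.H := {h | o h ≠ o' h}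

/-- The orientation towards the 0-cube `x`. -/
def ori (x : X.V) : X.H → Bool := fun h => X.side h x

/-- An orientation that agrees with some 0-cube on every finite set of hyperplanes. -/
def Approx (o : X.H → Bool) : Prop :=
  ∀ F : Set X.H, F.Finite → ∃ z : X.V, ∀ h ∈ F, X.side h z = o h

/-- The 0-cube `y` lies in the interval spanned by the 0-cube `x` and the orientation `o`. -/
def Btw (x y : X.V) (o : X.H → Bool) : Prop := ∀ h, X.side h x = o h → X.side h y = o h

/-- The median of three orientations. -/
def maj (o₁ o₂ o₃ : X.H → Bool) : X.H → Bool :=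
  fun h => (o₁ h && o₂ h) || (o₁ h && o₃ h) || (o₂ h && o₃ h)

lemma maj_of_eq_left {o₁ o₂ o₃ : X.H → Bool} {h : X.H} (e : o₁ h = o₂ h) :
    maj o₁ o₂ o₃ h = o₁ h := by
  revert e; simp only [maj]; cases o₁ h <;> cases o₂ h <;> cases o₃ h <;> simp

lemma maj_of_eq_mid {o₁ o₂ o₃ : X.H → Bool} {h : X.H} (e : o₁ h = o₃ h) :
    maj o₁ o₂ o₃ h = o₁ h := by
  revert e; simp only [maj]; cases o₁ h <;> cases o₂ h <;> cases o₃ h <;> simp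

lemma maj_of_eq_right {o₁ o₂ o₃ : X.H → Bool} {h : X.H} (e : o₂ h = o₃ h) :
    maj o₁ o₂ o₃ h = o₂ h := by
  revert e; simp only [maj]; cases o₁ h <;> cases o₂ h <;> cases o₃ h <;> simp

lemma approx_ori (x : X.V) : Approx (ori x) := fun _ _ => ⟨x, fun _ _ => rfl⟩

lemma Approx.pair {o : X.H → Bool} (ho : Approx o) (h k : X.H) :
    ∃ y, X.side h y = o h ∧ X.side k y = o k := by
  obtain ⟨z, hz⟩ := ho {h, k} (by simp)
  exact ⟨z, hz h (by simp), hz k (by simp)⟩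

lemma Approx.exists_vertex {o : X.H → Bool} (ho : Approx o) (x : X.V)
    (hf : (diff o (ori x)).Finite) : ∃ y, ∀ h, X.side h y = o h :=
  X.realize o x ho.pair hf

lemma exists_maj_vertex (x y : X.V) {o : X.H → Bool} (ho : Approx o) :
    ∃ m, ∀ h, X.side h m = maj (ori x) (ori y) o h := by
  apply X.realize _ x
  · intro h k
    obtain ⟨z, hz, hz'⟩ := ho.pair h k
    by_cases h1 : X.side h x = X.side h y
    · by_cases h2 : X.side k x = maj (ori x) (ori y) o k
      · exact ⟨x, (maj_of_eq_left (o₁ := ori x) (o₂ := ori y) h1).symm, h2⟩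
      · refine ⟨y, h1.symm.trans (maj_of_eq_left (o₁ := ori x) (o₂ := ori y) h1).symm, ?_⟩
        revert h2; simp only [maj, ori]
        cases X.side k x <;> cases X.side k y <;> cases o k <;> simp
    · by_cases h2 : X.side k x = X.side k y
      · by_cases h3 : X.side h x = maj (ori x) (ori y) o h
        · exact ⟨x, h3, (maj_of_eq_left (o₁ := ori x) (o₂ := ori y) h2).symm⟩
        · refine ⟨y, ?_, h2.symm.trans (maj_of_eq_left (o₁ := ori x) (o₂ := ori y) h2).symm⟩
          revert h3; simp only [maj, ori]
          cases X.side h x <;> cases X.side h y <;> cases o h <;> simp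
      · refine ⟨z, ?_, ?_⟩
        · revert h1; rw [hz]; simp only [maj, ori]
          cases X.side h x <;> cases X.side h y <;> cases o h <;> simp
        · revert h2; rw [hz']; simp only [maj, ori]
          cases X.side k x <;> cases X.side k y <;> cases o k <;> simp
  · refine (X.sep_finite x y).subset fun h hh => ?_
    revert hh; simp only [maj, ori, Set.mem_ofPred_eq]
    cases X.side h x <;> cases X.side h y <;> cases o h <;> simp

lemma Approx.maj {o o' : X.H → Bool} (x : X.V) (ho : Approx o) (ho' : Approx o') :
    Approx (maj (ori x) o o') := by
  intro F hF
  obtain ⟨z, hz⟩ := ho F hF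
  obtain ⟨z', hz'⟩ := ho' F hF
  obtain ⟨m, hm⟩ := exists_maj_vertex x z (approx_ori z')
  refine ⟨m, fun h hh => ?_⟩
  rw [hm]
  simp [CCC.maj, ori, hz h hh, hz' h hh]

lemma diff_maj (x : X.V) (o o' : X.H → Bool) :
    diff (maj (ori x) o o') (ori x) = diff o (ori x) ∩ diff o' (ori x) := by
  ext h
  simp only [diff, maj, ori, Set.mem_ofPred_eq, Set.mem_inter_iff]
  cases X.side h x <;> cases o h <;> cases o' h <;> simp

/-! ### The combinatorial metric -/

/-- The hyperplanes separating two 0-cubes. -/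
def sep (x y : X.V) : Set X.H := {h | X.side h x ≠ X.side h y}

lemma finite_sep (x y : X.V) : (sep x y).Finite := X.sep_finite x y

lemma dist_eq (x y : X.V) : X.dist x y = (sep x y).ncard := by
  rw [Set.ncard_eq_toFinset_card _ (finite_sep x y)]; rfl

lemma sep_comm (x y : X.V) : sep x y = sep y x := by
  ext h; exact ne_comm

lemma dist_comm (x y : X.V) : X.dist x y = X.dist y x := by
  rw [dist_eq, dist_eq, sep_comm]

lemma dist_self (x : X.V) : X.dist x x = 0 := by
  simp [dist_eq, sep]

lemma dist_mono {x y x' y' : X.V} (h : sep x y ⊆ sep x' y') : X.dist x y ≤ X.dist x' y' := by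
  rw [dist_eq, dist_eq]; exact Set.ncard_le_ncard h (finite_sep _ _)

lemma dist_lt {x y x' y' : X.V} (h : sep x y ⊂ sep x' y') : X.dist x y < X.dist x' y' := by
  rw [dist_eq, dist_eq]; exact Set.ncard_lt_ncard h (finite_sep _ _)

lemma dist_triangle (x y z : X.V) : X.dist x z ≤ X.dist x y + X.dist y z := by
  rw [dist_eq, dist_eq, dist_eq]
  refine le_trans (Set.ncard_le_ncard ?_ ((finite_sep x y).union (finite_sep y z)))
    (Set.ncard_union_le _ _)
  intro h hh
  by_contra hc
  simp only [sep, Set.mem_union, Set.mem_ofPred_eq, not_or, not_not] at hc hh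
  exact hh (hc.1.trans hc.2)

lemma exists_sep_of_ne {x y : X.V} (h : x ≠ y) : (sep x y).Nonempty := by
  by_contra hc
  refine h (X.vertex_ext x y fun k => ?_)
  by_contra hk
  exact hc ⟨k, hk⟩

lemma dist_pos {x y : X.V} (h : x ≠ y) : 0 < X.dist x y := by
  rw [dist_eq]
  exact (Set.ncard_pos (finite_sep x y)).2 (exists_sep_of_ne h)

lemma Btw.refl (x : X.V) (o : X.H → Bool) : Btw x x o := fun _ h => h

lemma Btw.trans {x y z : X.V} {o : X.H → Bool} (h : Btw x y o) (h' : Btw y z o) : Btw x z o :=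
  fun k hk => h' k (h k hk)

lemma Btw.trans_ori {x y z : X.V} {o : X.H → Bool} (h : Btw x y o) (h' : Btw x z (ori y)) :
    Btw x z o := fun k hk => (h' k (hk.trans (h k hk).symm)).trans (h k hk)

lemma Btw.sep_subset {x y z : X.V} (h : Btw x y (ori z)) : sep x y ⊆ sep x z := by
  intro k hk hc
  exact hk (hc.trans (h k hc).symm)

lemma Btw.sep_subset_right {x y z : X.V} (h : Btw x y (ori z)) : sep y z ⊆ sep x z := by
  intro k hk hc
  exact hk (h k hc)

/-- For distinct 0-cubes `x`, `z` there is a neighbour of `x` between them. -/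
lemma exists_adj {x z : X.V} (hxz : x ≠ z) : ∃ y, X.Adj x y ∧ Btw x y (ori z) := by
  classical
  have hex : ∃ n, ∃ y, y ≠ x ∧ Btw x y (ori z) ∧ X.dist x y = n :=
    ⟨_, z, hxz.symm, fun _ _ => rfl, rfl⟩
  obtain ⟨y, hy, hb, hd⟩ := Nat.find_spec hex
  refine ⟨y, ?_, hb⟩
  have key : ∀ h ∈ sep x y, ∀ k ∈ sep x y, ∀ w, w ∈ X.Hs h (X.side h x) →
      w ∉ X.Hs k (X.side k x) → False := by
    intro h hh k hk w hwh hwk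
    obtain ⟨m, hm⟩ := exists_maj_vertex x y (approx_ori w)
    have hbm : Btw x m (ori y) := by
      intro l hl
      rw [hm]; exact (maj_of_eq_left (o₁ := ori x) (o₂ := ori y) hl).trans hl
    have h1 : X.side h m = X.side h x := by
      rw [hm]; exact maj_of_eq_mid (o₁ := ori x) (Eq.symm hwh)
    have h2 : X.side k m ≠ X.side k x := by
      rw [hm]; simp only [maj, ori, Hs, Set.mem_ofPred_eq, sep] at hwk hk ⊢
      revert hwk hk
      cases X.side k x <;> cases X.side k y <;> cases X.side k w <;> simp
    refine Nat.find_min hex (m := X.dist x m) ?_ ⟨m, ?_, hb.trans_ori hbm, rfl⟩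
    · rw [← hd]
      refine dist_lt ⟨hbm.sep_subset, fun hc => ?_⟩
      exact hc hh h1.symm
    · rintro rfl; exact h2 rfl
  obtain ⟨h, hh⟩ := exists_sep_of_ne hy.symm
  refine ⟨h, hh, fun k hk => ?_⟩
  have hiff : ∀ w, X.side h w = X.side h x ↔ X.side k w = X.side k x := by
    intro w
    constructor
    · intro h1; by_contra h2; exact key h hh k hk w h1 h2
    · intro h1; by_contra h2; exact key k hk h hh w h1 h2
  by_cases hs : X.side k x = X.side h x
  · refine X.hyp_inj k h fun w => ?_
    have := hiff w
    revert this hs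
    cases X.side k x <;> cases X.side h x <;> cases X.side k w <;> cases X.side h w <;> simp
  · refine X.hyp_inj' k h fun w => ?_
    have := hiff w
    revert this hs
    cases X.side k x <;> cases X.side h x <;> cases X.side k w <;> cases X.side h w <;> simp

lemma Adj.exists_sep_eq {x y : X.V} (h : X.Adj x y) : ∃ k, sep x y = {k} := by
  obtain ⟨k, hk, hu⟩ := h
  refine ⟨k, Set.eq_singleton_iff_unique_mem.2 ⟨hk, fun l hl => hu l hl⟩⟩

lemma dist_of_adj {x y : X.V} (h : X.Adj x y) : X.dist x y = 1 := by
  obtain ⟨k, hk⟩ := Adj.exists_sep_eq h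
  rw [dist_eq, hk, Set.ncard_singleton]

lemma Btw.dist_add {x y z : X.V} (h : Btw x y (ori z)) :
    X.dist x z = X.dist x y + X.dist y z := by
  rw [dist_eq, dist_eq, dist_eq, ← Set.ncard_union_eq ?_ (finite_sep _ _) (finite_sep _ _)]
  · congr 1
    refine Set.Subset.antisymm ?_ (Set.union_subset h.sep_subset h.sep_subset_right)
    intro k hk
    by_contra hc
    simp only [sep, Set.mem_union, Set.mem_ofPred_eq, not_or, not_not] at hc hk
    exact hk (hc.1.trans hc.2)
  · rw [Set.disjoint_left]
    intro k hk hk'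
    have := h k
    revert this hk hk'
    simp only [sep, ori, Set.mem_ofPred_eq]
    cases X.side k x <;> cases X.side k y <;> cases X.side k z <;> simp

/-! ### Avoiding paths -/

lemma AvoidPathLen.refl {x₀ : X.V} {r : ℕ} {a : X.V} (h : r ≤ X.dist a x₀) :
    X.AvoidPathLen x₀ r a a 0 :=
  ⟨fun _ => a, rfl, rfl, by simp, fun _ _ => h⟩

lemma AvoidPathLen.trans {x₀ : X.V} {r : ℕ} {a b c : X.V} {m n : ℕ}
    (h : X.AvoidPathLen x₀ r a b m) (h' : X.AvoidPathLen x₀ r b c n) :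
    X.AvoidPathLen x₀ r a c (m + n) := by
  obtain ⟨p, hp0, hpm, hpa, hpr⟩ := h
  obtain ⟨q, hq0, hqn, hqa, hqr⟩ := h'
  refine ⟨fun i => if i ≤ m then p i else q (i - m), by simp [hp0], ?_, ?_, ?_⟩
  · by_cases hn : n = 0
    · subst hn; simp [hpm, ← hqn, hq0]
    · simp [hn, hqn]
  · intro i hi
    rcases lt_trichotomy i m with h1 | h1 | h1
    · simpa [h1.le, Nat.succ_le_of_lt h1] using hpa i h1
    · subst h1
      have := hqa 0 (by omega)
      simpa [hpm, ← hq0] using this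
    · have := hqa (i - m) (by omega)
      simp only [show ¬ i ≤ m by omega, show ¬ i + 1 ≤ m by omega, if_false]
      rwa [show i + 1 - m = i - m + 1 by omega]
  · intro i hi
    dsimp only
    split_ifs with h1
    · exact hpr i h1
    · exact hqr _ (by omega)

lemma AvoidPathLen.of_adj {x₀ : X.V} {r : ℕ} {a b : X.V} (h : X.Adj a b)
    (ha : r ≤ X.dist a x₀) (hb : r ≤ X.dist b x₀) : X.AvoidPathLen x₀ r a b 1 := by
  refine ⟨fun i => if i = 0 then a else b, by simp, by simp, ?_, ?_⟩
  · intro i hi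
    obtain rfl : i = 0 := by omega
    simpa using h
  · intro i _
    dsimp only
    split_ifs <;> assumption

/-- A geodesic between two 0-cubes whose interval avoids a ball. -/
lemma avoidPathLen_dist {x₀ : X.V} {r : ℕ} {a b : X.V}
    (h : ∀ z, Btw a z (ori b) → r ≤ X.dist z x₀) :
    X.AvoidPathLen x₀ r a b (X.dist a b) := by
  induction hn : X.dist a b generalizing a with
  | zero =>
    obtain rfl : a = b := by
      by_contra hab
      have := dist_pos hab
      omega
    exact .refl (h a (.refl _ _))
  | succ n ih =>
    have hab : a ≠ b := by
      rintro rfl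
      rw [dist_self] at hn; omega
    obtain ⟨y, hy, hyb⟩ := exists_adj hab
    have h1 := hyb.dist_add
    rw [dist_of_adj hy] at h1
    have h2 := ih (a := y) (fun z hz => h z (hyb.trans hz)) (by omega)
    have h3 := (AvoidPathLen.of_adj hy (h a (.refl _ _)) (h y hyb)).trans h2
    rwa [Nat.add_comm] at h3

/-- Two 0-cubes at distance `r` from `x₀` in a common interval based at `x₀` are joined by
an `r`-avoiding path through their join. -/
lemma exists_avoidPathLen_of_btw {x₀ p q : X.V} {o : X.H → Bool} {r : ℕ} (ho : Approx o)
    (hp : Btw x₀ p o) (hq : Btw x₀ q o) (hpr : X.dist x₀ p = r) (hqr : X.dist x₀ q = r) :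
    ∃ n ≤ 2 * r, X.AvoidPathLen x₀ r p q n := by
  obtain ⟨j, hj⟩ := exists_maj_vertex p q ho
  have hj' : ∀ h, X.side h j =
      ((X.side h p && X.side h q) || (X.side h p && o h) || (X.side h q && o h)) := hj
  have h1 : X.dist p j ≤ r := by
    rw [← hqr]
    refine dist_mono fun h hh => ?_
    have a := hp h; have b := hq h; have c := hj' h
    revert a b c hh
    simp only [sep, Set.mem_ofPred_eq]
    cases X.side h x₀ <;> cases X.side h p <;> cases X.side h q <;> cases X.side h j <;>
      cases o h <;> simp
  have h2 : X.dist j q ≤ r := by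
    rw [← hpr]
    refine dist_mono fun h hh => ?_
    have a := hp h; have b := hq h; have c := hj' h
    revert a b c hh
    simp only [sep, Set.mem_ofPred_eq]
    cases X.side h x₀ <;> cases X.side h p <;> cases X.side h q <;> cases X.side h j <;>
      cases o h <;> simp
  refine ⟨X.dist p j + X.dist j q, by omega, (avoidPathLen_dist ?_).trans (avoidPathLen_dist ?_)⟩
  · intro z hz
    rw [dist_comm, ← hpr]
    refine dist_mono fun h hh => ?_
    have a := hp h; have b := hq h; have c := hj' h; have d := hz h
    revert a b c d hh
    simp only [sep, Set.mem_ofPred_eq, ori]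
    cases X.side h x₀ <;> cases X.side h p <;> cases X.side h q <;> cases X.side h j <;>
      cases o h <;> cases X.side h z <;> simp
  · intro z hz
    rw [dist_comm, ← hqr]
    refine dist_mono fun h hh => ?_
    have a := hp h; have b := hq h; have c := hj' h; have d := hz h
    revert a b c d hh
    simp only [sep, Set.mem_ofPred_eq, ori]
    cases X.side h x₀ <;> cases X.side h p <;> cases X.side h q <;> cases X.side h j <;>
      cases o h <;> cases X.side h z <;> simp

/-- Any hyperplane not yet crossed on the way to `o` can be crossed within the interval. -/
lemma exists_btw_side_eq {o : X.H → Bool} (ho : Approx o) (q : X.V) (h : X.H) :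
    ∃ y, Btw q y o ∧ X.side h y = o h := by
  obtain ⟨z, hz⟩ := ho {h} (by simp)
  have hz := hz h rfl
  obtain ⟨m, hm⟩ := exists_maj_vertex q z ho
  refine ⟨m, fun k hk => ?_, ?_⟩
  · rw [hm, ← hk]; exact maj_of_eq_mid hk
  · rw [hm, ← hz]; exact maj_of_eq_right hz

/-- An interval towards an orientation infinitely far from `x` has 0-cubes at each distance. -/
lemma exists_btw_dist_eq {o : X.H → Bool} (ho : Approx o) {x : X.V}
    (hinf : (diff o (ori x)).Infinite) (r : ℕ) : ∃ q, Btw x q o ∧ X.dist x q = r := by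
  induction r with
  | zero => exact ⟨x, .refl _ _, dist_self x⟩
  | succ r ih =>
    obtain ⟨q, hq, hd⟩ := ih
    obtain ⟨h, hh, hh'⟩ := (hinf.sdiff (finite_sep x q)).nonempty
    obtain ⟨y, hy, hy'⟩ := exists_btw_side_eq ho q h
    have hqy : q ≠ y := by
      rintro rfl
      simp only [diff, sep, ori, Set.mem_ofPred_eq, not_not] at hh hh'
      exact hh (hy'.symm.trans hh'.symm)
    obtain ⟨w, hw, hwb⟩ := exists_adj hqy
    have hqw := hy.trans_ori hwb
    refine ⟨w, hq.trans hqw, ?_⟩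
    have hxqw : Btw x q (ori w) := by
      intro k hk
      by_contra hc
      have hc' : X.side k q ≠ X.side k w := hc
      have a := hq k; have b := hqw k
      revert a b hc' hk; simp only [ori]
      cases X.side k x <;> cases X.side k q <;> cases X.side k w <;> cases o k <;> simp
    rw [hxqw.dist_add, dist_of_adj hw, hd]

/-! ### The order on hyperplanes seen from a 0-cube -/

/-- From `x`, the hyperplane `k` can only be crossed after `h`. -/
def Prec (x : X.V) (h k : X.H) : Prop :=
  ∀ y, X.side k y ≠ X.side k x → X.side h y ≠ X.side h x

lemma Prec.refl (x : X.V) (h : X.H) : Prec x h h := fun _ hy => hy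

instance (x : X.V) : IsTrans X.H (flip (Prec x)) :=
  ⟨fun _ _ _ h h' y hy => h' y (h y hy)⟩

instance (x : X.V) : IsTrans X.H (Prec x) :=
  ⟨fun _ _ _ h h' y hy => h y (h' y hy)⟩

lemma exists_side_ne (x : X.V) (k : X.H) : ∃ y, X.side k y ≠ X.side k x := by
  obtain ⟨y, hy⟩ := X.halfspace_nonempty k (!(X.side k x))
  exact ⟨y, by simp [hy]⟩

lemma finite_prec (x : X.V) (k : X.H) : {h | Prec x h k}.Finite := by
  obtain ⟨y, hy⟩ := exists_side_ne x k
  exact (finite_sep y x).subset fun h hh => hh y hy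

lemma Prec.antisymm {x : X.V} {h k : X.H} (h₁ : Prec x h k) (h₂ : Prec x k h) : h = k := by
  have hiff : ∀ y, X.side h y = X.side h x ↔ X.side k y = X.side k x := fun y =>
    ⟨fun e => by_contra fun hc => h₁ y hc e, fun e => by_contra fun hc => h₂ y hc e⟩
  by_cases hs : X.side h x = X.side k x
  · refine X.hyp_inj h k fun w => ?_
    have := hiff w
    revert this hs
    cases X.side k x <;> cases X.side h x <;> cases X.side k w <;> cases X.side h w <;> simp
  · refine X.hyp_inj' h k fun w => ?_
    have := hiff w
    revert this hs
    cases X.side k x <;> cases X.side h x <;> cases X.side k w <;> cases X.side h w <;> simp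

/-- The halfspaces of `h` and `k` not containing `x` are disjoint. -/
def Away (x : X.V) (h k : X.H) : Prop :=
  ∀ y, X.side h y ≠ X.side h x → X.side k y = X.side k x

lemma Away.symm {x : X.V} {h k : X.H} (hk : Away x h k) : Away x k h :=
  fun y hy => by_contra fun hc => hy (hk y hc)

lemma crosses_of_not_prec {x : X.V} {h k : X.H} (h₁ : ¬ Prec x h k) (h₂ : ¬ Prec x k h)
    (h₃ : ¬ Away x h k) : X.Crosses h k := by
  simp only [Prec, Away, not_forall, not_not] at h₁ h₂ h₃
  obtain ⟨y₁, a₁, b₁⟩ := h₁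
  obtain ⟨y₂, a₂, b₂⟩ := h₂
  obtain ⟨y₃, a₃, b₃⟩ := h₃
  intro b b'
  by_cases hb : b = X.side h x <;> by_cases hb' : b' = X.side k x
  · exact ⟨x, hb.symm, hb'.symm⟩
  · refine ⟨y₁, b₁.trans hb.symm, ?_⟩
    revert a₁ hb'; cases X.side k y₁ <;> cases X.side k x <;> cases b' <;> simp
  · refine ⟨y₂, ?_, b₂.trans hb'.symm⟩
    revert a₂ hb; cases X.side h y₂ <;> cases X.side h x <;> cases b <;> simp
  · refine ⟨y₃, ?_, ?_⟩
    · revert a₃ hb; cases X.side h y₃ <;> cases X.side h x <;> cases b <;> simp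
    · revert b₃ hb'; cases X.side k y₃ <;> cases X.side k x <;> cases b' <;> simp

lemma inHalf_of_away {x : X.V} {h k : X.H} (hk : Away x h k) :
    X.InHalf h k (X.side k x) := by
  refine ⟨?_, X.side h x, fun y hy => ?_⟩
  · rintro rfl
    obtain ⟨y, hy⟩ := exists_side_ne x h
    exact hy (hk y hy)
  · exact hk.symm y (by simp [hy])

lemma inHalf_of_prec {x : X.V} {h k : X.H} (hne : h ≠ k) (hk : Prec x h k) :
    X.InHalf k h (!(X.side h x)) := by
  refine ⟨hne.symm, X.side k x, fun y hy => ?_⟩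
  by_contra hc
  exact hk y hc (by simpa using hy)

lemma inHalf_of_prec' {x : X.V} {h k : X.H} (hne : h ≠ k) (hk : Prec x h k) :
    X.InHalf h k (X.side k x) := by
  refine ⟨hne, !(X.side h x), fun y hy => ?_⟩
  have := hk y (by simp [hy])
  revert this; cases X.side h y <;> cases X.side h x <;> simp

lemma prec_of_inHalf {x : X.V} {h k : X.H} {b : Bool} (hk : X.InHalf k h b)
    (hb : b ≠ X.side h x) : Prec x h k := by
  obtain ⟨_, c, hc⟩ := hk
  intro y hy hy'
  have hb' : X.side h x = !b := by revert hb; cases X.side h x <;> cases b <;> simp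
  exact hy ((hc y (hy'.trans hb')).trans (hc x hb').symm)

/-- Every downward closed set of hyperplanes is inseparable. -/
lemma inseparable_of_isLower {x : X.V} {D : Set X.H}
    (hD : ∀ k ∈ D, ∀ h, Prec x h k → h ∈ D) : X.Inseparable D := by
  rintro u hu u' hu' h ⟨b, h₁, h₂⟩
  by_cases hb : b = X.side h x
  · exact hD u' hu' h (prec_of_inHalf h₂ (by rw [hb]; cases X.side h x <;> simp))
  · exact hD u hu h (prec_of_inHalf h₁ hb)

/-! ### Unidirectional boundary sets -/

lemma Unidirectional.mono {U W : Set X.H} (hW : X.Unidirectional W) (h : U ⊆ W) :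
    X.Unidirectional U := fun u hu => by
  obtain ⟨b, hb⟩ := hW u (h hu)
  exact ⟨b, hb.subset fun k hk => ⟨h hk.1, hk.2⟩⟩

lemma NoFacingTriple.mono {U W : Set X.H} (hW : X.NoFacingTriple W) (h : U ⊆ W) :
    X.NoFacingTriple U := fun _ h₁ _ h₂ _ h₃ => hW _ (h h₁) _ (h h₂) _ (h h₃)

lemma IsUBS.of_subset {U W : Set X.H} (hW : X.IsUBS W) (h : U ⊆ W) (hi : U.Infinite)
    (hs : X.Inseparable U) : X.IsUBS U :=
  ⟨hi, hs, hW.2.2.1.mono h, hW.2.2.2.mono h⟩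

lemma AlmostEq.symm {U V : Set X.H} (h : X.AlmostEq U V) : X.AlmostEq V U := by
  rwa [AlmostEq, symmDiff_comm]

lemma AlmostEq.refl (U : Set X.H) : X.AlmostEq U U := by simp [AlmostEq]

lemma AlmostEq.finite_sdiff {U V : Set X.H} (h : X.AlmostEq U V) : (U \ V).Finite :=
  h.subset Set.subset_union_left

lemma finite_sdiff_trans {α : Type*} {A B C : Set α} (h : (A \ B).Finite) (h' : (B \ C).Finite) :
    (A \ C).Finite :=
  (h.union h').subset fun a ha => by
    by_cases hb : a ∈ B
    · exact Or.inr ⟨hb, ha.2⟩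
    · exact Or.inl ⟨ha.1, hb⟩

lemma infinite_inter {α : Type*} {A B : Set α} (hA : A.Infinite) (h : (A \ B).Finite) :
    (A ∩ B).Infinite := by
  have := hA.sdiff h
  rwa [Set.sdiff_sdiff_right_self] at this

lemma isLower_diff {o : X.H → Bool} {x : X.V} (ho : Approx o) :
    ∀ k ∈ diff o (ori x), ∀ h, Prec x h k → h ∈ diff o (ori x) := by
  intro k hk h hh
  obtain ⟨y, h₁, h₂⟩ := ho.pair h k
  have := hh y (by rw [h₂]; exact hk)
  rwa [h₁] at this

lemma isUBS_diff {o : X.H → Bool} {x : X.V} (ho : Approx o)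
    (hinf : (diff o (ori x)).Infinite) : X.IsUBS (diff o (ori x)) := by
  refine ⟨hinf, inseparable_of_isLower (isLower_diff ho), fun u hu => ?_, ?_⟩
  · refine ⟨X.side u x, ?_⟩
    obtain ⟨y, hy⟩ := exists_side_ne x u
    refine (finite_sep y x).subset ?_
    rintro h ⟨hh, _, c, hc⟩
    obtain ⟨z, h₁, h₂⟩ := ho.pair h u
    have e₁ := hc y (by revert hy; cases X.side u x <;> cases X.side u y <;> simp)
    have e₂ := hc z (by
      have : X.side u z ≠ X.side u x := by rw [h₂]; exact hu
      revert this; cases X.side u x <;> cases X.side u z <;> simp)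
    change X.side h y ≠ X.side h x
    rw [e₁, ← e₂, h₁]; exact hh
  · rintro h₁ m₁ h₂ m₂ h₃ m₃ ⟨n₁₂, n₁₃, n₂₃, b₁, b₂, b₃, i₂₁, i₃₁, i₁₂, i₃₂, i₁₃, i₂₃⟩
    have key : ∀ h k : X.H, ∀ b c : Bool, X.InHalf k h b → X.InHalf h k c →
        ∀ y, X.side h y = !b → X.side k y = c := by
      rintro h k b c ⟨hne, d, hd⟩ ⟨_, e, he⟩ y hy
      by_contra hc
      have hdc : d = !c := by
        have := hd y hy
        revert this hc; cases X.side k y <;> cases c <;> cases d <;> simp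
      have heb : e = !b := by
        rw [← hy, he y (by revert hc; cases X.side k y <;> cases c <;> simp)]
      have hiff : ∀ w, X.side h w = !b ↔ X.side k w = !c := fun w =>
        ⟨fun e => (hd w e).trans hdc, fun e => (he w e).trans heb⟩
      by_cases hbc : b = c
      · refine hne (X.hyp_inj k h fun w => ?_)
        have := hiff w
        revert this hbc
        cases X.side k w <;> cases X.side h w <;> cases b <;> cases c <;> simp
      · refine hne (X.hyp_inj' k h fun w => ?_)
        have := hiff w
        revert this hbc
        cases X.side k w <;> cases X.side h w <;> cases b <;> cases c <;> simp
    have kx := fun h k b c i j => key h k b c i j x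
    have ko : ∀ h k : X.H, ∀ b c : Bool, X.InHalf k h b → X.InHalf h k c →
        o h = (!b) → o k = c := by
      intro h k b c i j e
      obtain ⟨y, e₁, e₂⟩ := ho.pair h k
      exact e₂.symm.trans (key h k b c i j y (e₁.trans e))
    have x₁₂ := kx _ _ _ _ i₂₁ i₁₂
    have x₁₃ := kx _ _ _ _ i₃₁ i₁₃
    have x₂₃ := kx _ _ _ _ i₃₂ i₂₃
    have o₁₂ := ko _ _ _ _ i₂₁ i₁₂
    have o₁₃ := ko _ _ _ _ i₃₁ i₁₃
    have o₂₃ := ko _ _ _ _ i₃₂ i₂₃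
    simp only [diff, ori, Set.mem_ofPred_eq] at m₁ m₂ m₃
    clear kx ko key i₂₁ i₁₂ i₃₁ i₁₃ i₃₂ i₂₃ n₁₂ n₁₃ n₂₃ hinf
    revert x₁₂ x₁₃ x₂₃ o₁₂ o₁₃ o₂₃ m₁ m₂ m₃
    generalize X.side h₁ x = s₁, X.side h₂ x = s₂, X.side h₃ x = s₃
    generalize o h₁ = t₁, o h₂ = t₂, o h₃ = t₃
    revert s₁ s₂ s₃ t₁ t₂ t₃ b₁ b₂ b₃
    decide

/-! ### Well-quasi-ordering -/

/-- Antichains without facing triples are finite. -/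
lemma finite_antichain (hnc : X.NoInfiniteCrossing) (x : X.V) {S : Set X.H}
    (hS : X.NoFacingTriple S) (ha : ∀ h ∈ S, ∀ k ∈ S, h ≠ k → ¬ Prec x h k) : S.Finite := by
  by_contra hinf
  let cl : Set (Set X.H) := {C | C ⊆ S ∧ C.Pairwise X.Crosses}
  obtain ⟨C, hC⟩ : ∃ C, Maximal (· ∈ cl) C := by
    refine zorn_subset cl fun c hc hch => ⟨⋃₀ c, ⟨Set.sUnion_subset fun s hs => (hc hs).1, ?_⟩,
      fun s hs => Set.subset_sUnion_of_mem hs⟩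
    exact (Set.pairwise_sUnion hch.directedOn).2 fun s hs => (hc hs).2
  have hCfin : C.Finite := hnc C fun h hh k hk hne => hC.prop.2 hh hk hne
  have hcross : ∀ h ∈ S, ∀ k ∈ S, h ≠ k → ¬ Away x h k → X.Crosses h k := fun h hh k hk hne hn =>
    crosses_of_not_prec (ha h hh k hk hne) (ha k hk h hh hne.symm) hn
  have hfin : ∀ c ∈ S, {s ∈ S | Away x c s}.Finite := by
    intro c hc
    refine hnc _ fun h hh k hk hne => hcross h hh.1 k hk.1 hne fun haw => ?_
    refine hS c hc h hh.1 k hk.1 ⟨(inHalf_of_away hh.2).1, (inHalf_of_away hk.2).1, hne,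
      _, _, _, inHalf_of_away hh.2.symm, inHalf_of_away hk.2.symm, inHalf_of_away hh.2,
      inHalf_of_away haw.symm, inHalf_of_away hk.2, inHalf_of_away haw⟩
  refine hinf ((hCfin.union (hCfin.biUnion fun c hc => hfin c (hC.prop.1 hc))).subset
    fun s hs => ?_)
  by_contra hns
  simp only [Set.mem_union, Set.mem_iUnion, not_or, not_exists] at hns
  have hcs : ∀ c ∈ C, X.Crosses s c ∧ X.Crosses c s := fun c hc => by
    have hne : s ≠ c := by rintro rfl; exact hns.1 hc
    have hna : ¬ Away x c s := fun h => hns.2 c hc ⟨hs, h⟩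
    exact ⟨hcross s hs c (hC.prop.1 hc) hne fun h => hna h.symm,
      hcross c (hC.prop.1 hc) s hs hne.symm hna⟩
  have hins : insert s C ∈ cl :=
    ⟨Set.insert_subset hs hC.prop.1, hC.prop.2.insert fun c hc _ => hcs c hc⟩
  exact hns.1 (hC.le_of_ge hins (Set.subset_insert _ _) (Set.mem_insert _ _))

lemma exists_lt_prec (hnc : X.NoInfiniteCrossing) (x : X.V) {S : Set X.H}
    (hS : X.NoFacingTriple S) (f : ℕ → X.H) (hf : ∀ n, f n ∈ S) :
    ∃ m n, m < n ∧ Prec x (f m) (f n) := by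
  by_contra! hbad
  have hinj : Function.Injective f := by
    intro m n e
    by_contra hne
    rcases lt_or_gt_of_ne hne with h | h
    · exact hbad _ _ h (e ▸ Prec.refl _ _)
    · exact hbad _ _ h (e ▸ Prec.refl _ _)
  obtain ⟨g, h | h⟩ := exists_increasing_or_nonincreasing_subseq (flip (Prec x)) f
  · refine Set.infinite_range_of_injective (f := fun n => f (g (n + 1)))
      (fun m n e => by simpa using g.injective (hinj e))
      ((finite_prec x (f (g 0))).subset ?_)
    rintro _ ⟨n, rfl⟩
    exact h 0 (n + 1) (Nat.succ_pos n)
  · refine Set.infinite_range_of_injective (f := fun n => f (g n))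
      (fun m n e => g.injective (hinj e)) (finite_antichain hnc x (hS.mono ?_) ?_)
    · rintro _ ⟨n, rfl⟩; exact hf _
    · rintro _ ⟨m, rfl⟩ _ ⟨n, rfl⟩ hne
      rcases lt_trichotomy m n with hmn | rfl | hmn
      · exact hbad _ _ (g.strictMono hmn)
      · exact absurd rfl hne
      · exact h n m hmn

/-- An infinite set without facing triples contains an infinite ascending chain. -/
lemma exists_chain (hnc : X.NoInfiniteCrossing) (x : X.V) {S : Set X.H}
    (hS : X.NoFacingTriple S) (hinf : S.Infinite) :
    ∃ f : ℕ → X.H, Function.Injective f ∧ (∀ n, f n ∈ S) ∧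
      ∀ m n, m ≤ n → Prec x (f m) (f n) := by
  let e := hinf.natEmbedding
  obtain ⟨g, h | h⟩ := exists_increasing_or_nonincreasing_subseq (Prec x) fun n => (e n : X.H)
  · refine ⟨fun n => e (g n), fun m n he => g.injective (e.injective (Subtype.ext he)),
      fun n => (e (g n)).2, fun m n hmn => ?_⟩
    rcases hmn.lt_or_eq with hlt | rfl
    · exact h m n hlt
    · exact .refl _ _
  · obtain ⟨m, n, hmn, hp⟩ :=
      exists_lt_prec hnc x hS (fun n => e (g n)) fun n => (e (g n)).2
    exact absurd hp (h m n hmn)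

/-- The set of hyperplanes crossed on the way to infinity contains a minimal UBS. -/
lemma exists_minUBS_subset (hnc : X.NoInfiniteCrossing) {o : X.H → Bool} {x : X.V}
    (ho : Approx o) (hinf : (diff o (ori x)).Infinite) :
    ∃ U ⊆ diff o (ori x), X.MinUBS U := by
  have hUBS := isUBS_diff ho hinf
  let P : Set X.H → Prop := fun D =>
    D ⊆ diff o (ori x) ∧ D.Infinite ∧ ∀ k ∈ D, ∀ h, Prec x h k → h ∈ D
  have hwf : WellFounded fun D E : {D // P D} => D.1 ⊂ E.1 := by
    rw [wellFounded_iff_isEmpty_descending_chain]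
    refine ⟨fun ⟨f, hf⟩ => ?_⟩
    choose h hh hh' using fun n => Set.exists_of_ssubset (hf n)
    obtain ⟨m, n, hmn, hp⟩ := exists_lt_prec hnc x hUBS.2.2.2 h
      fun n => (f n).2.1 (hh n)
    have hanti : Antitone fun n => (f n).1 := antitone_nat_of_succ_le fun n => (hf n).1
    exact hh' m ((f (m + 1)).2.2.2 _ (hanti (Nat.succ_le_of_lt hmn) (hh n)) _ hp)
  obtain ⟨⟨D, hDsub, hDinf, hDlow⟩, -, hmin⟩ := hwf.has_min Set.univ
    ⟨⟨_, subset_rfl, hinf, isLower_diff ho⟩, trivial⟩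
  have hcof : ∀ h ∈ D, {k ∈ D | ¬ Prec x h k}.Finite := by
    intro h hh
    by_contra hc
    refine hmin ⟨{k ∈ D | ¬ Prec x h k}, fun k hk => hDsub hk.1, hc, ?_⟩ trivial
      ⟨fun k hk => hk.1, fun hs => (hs hh).2 (.refl _ _)⟩
    intro k hk l hl
    exact ⟨hDlow k hk.1 l hl, fun hp => hk.2 (_root_.trans hp hl)⟩
  refine ⟨D, hDsub, hUBS.of_subset hDsub hDinf (inseparable_of_isLower hDlow),
    fun U hU hUU => ?_⟩
  obtain ⟨u, hu⟩ := hUU.1.nonempty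
  have hfin : (D \ U).Finite := by
    refine (hcof u (hU hu)).subset fun h hh => ⟨hh.1, fun hp => hh.2 ?_⟩
    obtain ⟨u', hu', hn⟩ := (hUU.1.sdiff ((hcof h hh.1).union (Set.finite_singleton h))).nonempty
    simp only [Set.mem_union, Set.mem_ofPred_eq, not_or, not_and, not_not,
      Set.mem_singleton_iff] at hn
    have hne : u ≠ h := by rintro rfl; exact hh.2 hu
    refine hUU.2.1 u hu u' hu' h ⟨X.side h x, inHalf_of_prec' hne hp, ?_⟩
    exact inHalf_of_prec (Ne.symm hn.2) (hn.1 (hU hu'))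
  rw [AlmostEq, Set.symmDiff_def, Set.sdiff_eq_empty.2 hU, Set.union_empty]
  exact hfin

open Filter

/-! ### Limits of sequences of 0-cubes -/

/-- `o` is the limit of `z` along a fixed nonprincipal ultrafilter. -/
def IsLim (z : ℕ → X.V) (o : X.H → Bool) : Prop :=
  ∀ h, ∀ᶠ n in (hyperfilter ℕ : Filter ℕ), X.side h (z n) = o h

lemma exists_isLim (z : ℕ → X.V) : ∃ o, IsLim z o := by
  have : ∀ h, ∃ b, ∀ᶠ n in (hyperfilter ℕ : Filter ℕ), X.side h (z n) = b := by
    intro h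
    by_cases hh : ∀ᶠ n in (hyperfilter ℕ : Filter ℕ), X.side h (z n) = true
    · exact ⟨true, hh⟩
    · refine ⟨false, (Ultrafilter.eventually_not.2 hh).mono fun n hn => by simpa using hn⟩
  choose o ho using this
  exact ⟨o, ho⟩

lemma IsLim.eventually {z : ℕ → X.V} {o : X.H → Bool} (h : IsLim z o) {F : Set X.H}
    (hF : F.Finite) : ∀ᶠ n in (hyperfilter ℕ : Filter ℕ), ∀ k ∈ F, X.side k (z n) = o k :=
  (eventually_all_finite hF).2 fun k _ => h k

lemma IsLim.approx {z : ℕ → X.V} {o : X.H → Bool} (h : IsLim z o) : Approx o := fun F hF => by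
  obtain ⟨n, hn⟩ := (h.eventually hF).exists
  exact ⟨z n, hn⟩

lemma eventually_hyperfilter {p : ℕ → Prop} (h : ∀ᶠ n in atTop, p n) :
    ∀ᶠ n in (hyperfilter ℕ : Filter ℕ), p n :=
  h.filter_mono Nat.hyperfilter_le_atTop

lemma IsLim.eq_of_eventually {z : ℕ → X.V} {o : X.H → Bool} (h : IsLim z o) {k : X.H} {b : Bool}
    (hk : ∀ᶠ n in atTop, X.side k (z n) = b) : o k = b := by
  obtain ⟨n, hn, hn'⟩ := ((h k).and (eventually_hyperfilter hk)).exists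
  exact hn.symm.trans hn'

lemma IsLim.maj {z z' : ℕ → X.V} {o o' : X.H → Bool} (x : X.V) (h : IsLim z o) (h' : IsLim z' o')
    {m : ℕ → X.V} (hm : ∀ n k, X.side k (m n) = maj (ori x) (ori (z n)) (ori (z' n)) k) :
    IsLim m (maj (ori x) o o') := by
  intro k
  filter_upwards [h k, h' k] with n hn hn'
  rw [hm]
  simp [CCC.maj, ori, hn, hn']

/-- In a locally finite complex, 0-cubes escaping to infinity cross infinitely many hyperplanes
in the limit. -/
lemma IsLim.infinite_diff (hlf : X.LocallyFinite) {z : ℕ → X.V} {o : X.H → Bool} (h : IsLim z o)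
    (x : X.V) (hz : Tendsto (fun n => X.dist x (z n)) atTop atTop) :
    (diff o (ori x)).Infinite := by
  intro hfin
  obtain ⟨q, hq⟩ := h.approx.exists_vertex x hfin
  have hE : (⋃ y ∈ {y | X.Adj q y}, sep q y).Finite :=
    (hlf q).biUnion fun y _ => finite_sep q y
  have h₁ := h.eventually hE
  have h₂ := eventually_hyperfilter (hz.eventually_gt_atTop (X.dist x q))
  obtain ⟨n, hn, hn'⟩ := (h₁.and h₂).exists
  have hne : q ≠ z n := by
    rintro e; rw [← e] at hn'; exact lt_irrefl _ hn'
  obtain ⟨y, hy, hyb⟩ := exists_adj hne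
  obtain ⟨k, hk⟩ := Adj.exists_sep_eq hy
  have hkm : k ∈ sep q y := hk ▸ rfl
  have e := hn k (Set.mem_biUnion hy hkm)
  exact hyb.sep_subset hkm ((hq k).trans e.symm)

/-! ### Geodesic rays -/

lemma IsGeodesicRay.side_ne {γ : ℕ → X.V} (hγ : X.IsGeodesicRay γ) {m n : ℕ} (hmn : m ≤ n)
    {h : X.H} (hm : X.side h (γ m) ≠ X.side h (γ 0)) : X.side h (γ n) ≠ X.side h (γ 0) := by
  intro hn
  have h₁ := hγ 0 m (Nat.zero_le _)
  have h₂ := hγ m n hmn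
  have h₃ := hγ 0 n (Nat.zero_le _)
  rw [dist_eq] at h₁ h₂ h₃
  have hsub : sep (γ 0) (γ n) ⊆ (sep (γ 0) (γ m) \ {h}) ∪ sep (γ m) (γ n) := by
    intro k hk
    by_cases hkm : X.side k (γ 0) = X.side k (γ m)
    · exact Or.inr fun e => hk (hkm.trans e)
    · refine Or.inl ⟨hkm, ?_⟩
      rintro rfl
      exact hk hn.symm
  have h₄ := Set.ncard_le_ncard hsub (((finite_sep _ _).sdiff).union (finite_sep _ _))
  have h₅ := Set.ncard_union_le (sep (γ 0) (γ m) \ {h}) (sep (γ m) (γ n))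
  have h₆ := Set.ncard_sdiff_singleton_lt_of_mem (show h ∈ sep (γ 0) (γ m) from hm.symm)
    (finite_sep _ _)
  omega

lemma IsLim.btw_ray {γ : ℕ → X.V} (hγ : X.IsGeodesicRay γ) {o : X.H → Bool} (ho : IsLim γ o)
    (r : ℕ) : Btw (γ 0) (γ r) o := by
  intro h hh
  by_contra hc
  have : o h = X.side h (γ r) := ho.eq_of_eventually <| eventually_atTop.2 ⟨r, fun n hn => by
    have h₁ : X.side h (γ r) ≠ X.side h (γ 0) := by rwa [hh]
    have h₂ := hγ.side_ne hn h₁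
    revert h₁ h₂
    cases X.side h (γ r) <;> cases X.side h (γ 0) <;> cases X.side h (γ n) <;> simp⟩
  exact hc this.symm

lemma IsLim.infinite_diff_ray {γ : ℕ → X.V} (hγ : X.IsGeodesicRay γ) {o : X.H → Bool}
    (ho : IsLim γ o) : (diff o (ori (γ 0))).Infinite := by
  intro hfin
  have hsub : sep (γ 0) (γ ((diff o (ori (γ 0))).ncard + 1)) ⊆ diff o (ori (γ 0)) := by
    intro h hh hc
    exact hh (hc.symm.trans (ho.btw_ray hγ _ h hc.symm).symm)
  have h₁ := Set.ncard_le_ncard hsub hfin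
  have h₂ := hγ 0 ((diff o (ori (γ 0))).ncard + 1) (Nat.zero_le _)
  rw [dist_eq] at h₂
  omega

/-- A geodesic ray from `x` towards `o` crossing infinitely many hyperplanes of `T`. -/
lemma exists_ray {o : X.H → Bool} (ho : Approx o) (x : X.V) {T : Set X.H} (hT : T.Infinite)
    (hTo : T ⊆ diff o (ori x)) :
    ∃ γ : ℕ → X.V, γ 0 = x ∧ X.IsGeodesicRay γ ∧
      ∀ o', IsLim γ o' → (T ∩ diff o' (ori x)).Infinite := by
  classical
  let Reach : X.V → ℕ → Prop := fun q d =>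
    ∃ y, Btw q y o ∧ (∃ h ∈ T, X.side h q ≠ o h ∧ X.side h y = o h) ∧ X.dist q y = d
  have hex : ∀ q, ∃ d, Reach q d := by
    intro q
    obtain ⟨h, hh, hq⟩ := (hT.sdiff (finite_sep x q)).nonempty
    obtain ⟨y, hy, hyh⟩ := exists_btw_side_eq ho q h
    refine ⟨_, y, hy, ⟨h, hh, fun hc => ?_, hyh⟩, rfl⟩
    have hq' : X.side h x = X.side h q := by simpa [sep] using hq
    exact hTo hh (hc.symm.trans hq'.symm)
  let f : X.V → ℕ := fun q => Nat.find (hex q)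
  have hstep : ∀ q, ∃ q', X.Adj q q' ∧ Btw q q' o ∧
      ((∃ h ∈ T, X.side h q ≠ o h ∧ X.side h q' = o h) ∨ f q' < f q) := by
    intro q
    obtain ⟨y, hy, ⟨h, hT, hq, hyh⟩, hd⟩ := Nat.find_spec (hex q)
    have hne : q ≠ y := by rintro rfl; exact hq hyh
    obtain ⟨w, hw, hwb⟩ := exists_adj hne
    refine ⟨w, hw, hy.trans_ori hwb, ?_⟩
    by_cases hwh : X.side h w = o h
    · exact Or.inl ⟨h, hT, hq, hwh⟩
    · right
      have h₁ : f w ≤ X.dist w y := Nat.find_le ⟨y, fun k hk => ?_, ⟨h, hT, hwh, hyh⟩, rfl⟩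
      · have h₂ := hwb.dist_add
        rw [dist_of_adj hw] at h₂
        change f w < Nat.find (hex q)
        omega
      · by_contra hc
        have a := hwb k
        have b := hy k
        revert hk hc a b
        simp only [ori]
        cases X.side k q <;> cases X.side k y <;> cases X.side k w <;> cases o k <;> simp
  choose s hs_adj hs_btw hs using hstep
  let γ : ℕ → X.V := fun n => s^[n] x
  have hγs : ∀ n, γ (n + 1) = s (γ n) := fun n => Function.iterate_succ_apply' s n x
  have hbtw : ∀ m n, m ≤ n → Btw (γ m) (γ n) o := by
    intro m n hmn
    induction n, hmn using Nat.le_induction with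
    | base => exact .refl _ _
    | succ n _ ih => exact ih.trans (hγs n ▸ hs_btw (γ n))
  have hgeo : X.IsGeodesicRay γ := by
    intro m n hmn
    induction n, hmn using Nat.le_induction with
    | base => simp [dist_self]
    | succ n hmn ih =>
      have hb : Btw (γ m) (γ n) (ori (γ (n + 1))) := by
        intro k hk
        have a := hbtw m n hmn k
        have b := hbtw n (n + 1) n.le_succ k
        revert hk a b
        simp only [ori]
        cases X.side k (γ m) <;> cases X.side k (γ n) <;> cases X.side k (γ (n + 1)) <;>
          cases o k <;> simp
      rw [hb.dist_add, ih, hγs, dist_of_adj (hs_adj _)]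
      omega
  have hcrossing : ∀ d n, f (γ n) ≤ d → ∃ n', n ≤ n' ∧
      ∃ h ∈ T, X.side h (γ n') ≠ o h ∧ X.side h (γ (n' + 1)) = o h := by
    intro d
    induction d with
    | zero =>
      intro n hn
      rcases hs (γ n) with h | h
      · exact ⟨n, le_rfl, by rwa [hγs]⟩
      · omega
    | succ d ih =>
      intro n hn
      rcases hs (γ n) with h | h
      · exact ⟨n, le_rfl, by rwa [hγs]⟩
      · obtain ⟨n', hn', h'⟩ := ih (n + 1) (by rw [hγs]; omega)
        exact ⟨n', by omega, h'⟩
  refine ⟨γ, rfl, hgeo, fun o' ho' hfin => ?_⟩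
  have hlim : ∀ h ∈ T, ∀ n, X.side h (γ n) = o h → h ∈ T ∩ diff o' (ori x) := by
    intro h hh n hn
    refine ⟨hh, ?_⟩
    have : o' h = o h := ho'.eq_of_eventually (eventually_atTop.2
      ⟨n, fun k hk => (hbtw n k hk h hn)⟩)
    change o' h ≠ _
    rw [this]; exact hTo hh
  have hev : ∀ᶠ n in atTop, ∀ h ∈ T ∩ diff o' (ori x),
      (∃ k, X.side h (γ k) = o h) → X.side h (γ n) = o h := by
    refine (eventually_all_finite hfin).2 fun h _ => ?_
    by_cases hk : ∃ k, X.side h (γ k) = o h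
    · obtain ⟨k, hk⟩ := hk
      exact eventually_atTop.2 ⟨k, fun n hn _ => hbtw k n hn h hk⟩
    · exact Eventually.of_forall fun n h => absurd h hk
  obtain ⟨N, hN⟩ := eventually_atTop.1 hev
  obtain ⟨n, hn, h, hh, hne, he⟩ := hcrossing _ N le_rfl
  exact hne (hN n hn h (hlim h hh _ he) ⟨_, he⟩)

/-! ### Visibility of pairs of minimal UBSs -/

/-- Infinite subsets of a UBS are met by the hyperplanes crossed towards a common limit. -/
lemma exists_approx_of_subset (hnc : X.NoInfiniteCrossing) (x : X.V) {W T T' : Set X.H}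
    (hW : X.IsUBS W) (hTW : T ⊆ W) (hTW' : T' ⊆ W) (hT : T.Infinite) (hT' : T'.Infinite) :
    ∃ o : X.H → Bool, Approx o ∧ (T ∩ diff o (ori x)).Infinite ∧
      (T' ∩ diff o (ori x)).Infinite := by
  obtain ⟨a, a_inj, haT, ha⟩ := exists_chain hnc x (hW.2.2.2.mono hTW) hT
  obtain ⟨b, b_inj, hbT, hb⟩ := exists_chain hnc x (hW.2.2.2.mono hTW') hT'
  have hmeet : ∀ n, ∃ z, X.side (a n) z ≠ X.side (a n) x ∧ X.side (b n) z ≠ X.side (b n) x := by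
    intro n
    by_contra! hc
    have haw : ∀ k, n ≤ k → Away x (a k) (b n) := fun k hk y hy => hc y (ha n k hk y hy)
    have h₁ : {h | h ∈ W ∧ X.InHalf h (b n) (X.side (b n) x)}.Infinite := by
      refine (Set.infinite_range_of_injective (f := fun k => a (n + k))
        fun k l e => by simpa using a_inj e).mono ?_
      rintro _ ⟨k, rfl⟩
      exact ⟨hTW (haT _), inHalf_of_away (haw _ (Nat.le_add_right _ _))⟩
    have h₂ : {h | h ∈ W ∧ X.InHalf h (b n) (!(X.side (b n) x))}.Infinite := by
      refine (Set.infinite_range_of_injective (f := fun k => b (n + 1 + k))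
        fun k l e => by simpa using b_inj e).mono ?_
      rintro _ ⟨k, rfl⟩
      refine ⟨hTW' (hbT _), inHalf_of_prec (fun e => ?_) (hb _ _ (by omega))⟩
      have := b_inj e
      omega
    obtain ⟨c, hc⟩ := hW.2.2.1 (b n) (hTW' (hbT n))
    by_cases hcx : c = X.side (b n) x
    · exact h₁ (hcx ▸ hc)
    · have : c = !(X.side (b n) x) := by
        revert hcx; cases c <;> cases X.side (b n) x <;> simp
      exact h₂ (this ▸ hc)
  choose z hza hzb using hmeet
  obtain ⟨o, ho⟩ := exists_isLim z
  refine ⟨o, ho.approx, ?_, ?_⟩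
  · refine (Set.infinite_range_of_injective a_inj).mono ?_
    rintro _ ⟨n, rfl⟩
    refine ⟨haT n, ?_⟩
    have : o (a n) = !(X.side (a n) x) := ho.eq_of_eventually (eventually_atTop.2
      ⟨n, fun k hk => Bool.eq_not.2 (ha n k hk _ (hza k))⟩)
    simp [diff, ori, this]
  · refine (Set.infinite_range_of_injective b_inj).mono ?_
    rintro _ ⟨n, rfl⟩
    refine ⟨hbT n, ?_⟩
    have : o (b n) = !(X.side (b n) x) := ho.eq_of_eventually (eventually_atTop.2
      ⟨n, fun k hk => Bool.eq_not.2 (hb n k hk _ (hzb k))⟩)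
    simp [diff, ori, this]

/-- A minimal UBS meeting the hyperplanes crossed towards `o` infinitely often is almost
contained in them. -/
lemma MinUBS.inter_diff {U : Set X.H} (hU : X.MinUBS U) {o : X.H → Bool} {x : X.V}
    (ho : Approx o) (hi : (U ∩ diff o (ori x)).Infinite) :
    X.IsUBS (U ∩ diff o (ori x)) ∧ X.AlmostEq U (U ∩ diff o (ori x)) ∧
      (U \ diff o (ori x)).Finite := by
  have hS := inseparable_of_isLower (isLower_diff (x := x) ho)
  have h₁ : X.IsUBS (U ∩ diff o (ori x)) :=
    hU.1.of_subset Set.inter_subset_left hi fun u hu u' hu' h hh =>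
      ⟨hU.1.2.1 u hu.1 u' hu'.1 h hh, hS u hu.2 u' hu'.2 h hh⟩
  have h₂ := hU.2 _ Set.inter_subset_left h₁
  refine ⟨h₁, h₂, ?_⟩
  have := AlmostEq.finite_sdiff h₂
  rwa [Set.sdiff_self_inter] at this

/-- Faces of a common simplex are almost contained in a set of hyperplanes crossed towards
infinity. -/
lemma exists_approx_of_faceOf (hnc : X.NoInfiniteCrossing) (x : X.V) {U V W : Set X.H}
    (hU : X.MinUBS U) (hV : X.MinUBS V) (hW : X.IsUBS W) (hUW : X.FaceOf U W)
    (hVW : X.FaceOf V W) :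
    ∃ o : X.H → Bool, Approx o ∧ (U \ diff o (ori x)).Finite ∧
      (V \ diff o (ori x)).Finite := by
  have key : ∀ A, X.FaceOf A W → (A \ W).Finite := by
    rintro A ⟨A', W', -, -, hA, hW', hsub⟩
    exact finite_sdiff_trans ((AlmostEq.finite_sdiff hA).subset
      (Set.sdiff_subset_sdiff_right hsub)) (AlmostEq.finite_sdiff (AlmostEq.symm hW'))
  obtain ⟨o, ho, h₁, h₂⟩ := exists_approx_of_subset hnc x hW Set.inter_subset_right
    Set.inter_subset_right (infinite_inter hU.1.1 (key U hUW))
    (infinite_inter hV.1.1 (key V hVW))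
  refine ⟨o, ho, (hU.inter_diff ho (h₁.mono ?_)).2.2, (hV.inter_diff ho (h₂.mono ?_)).2.2⟩ <;>
    exact Set.inter_subset_inter_left _ Set.inter_subset_left

lemma IsUBS.faceOf_self {U : Set X.H} (hU : X.IsUBS U) : X.FaceOf U U :=
  ⟨U, U, hU, hU, .refl U, .refl U, subset_rfl⟩

lemma exists_approx_of_minUBS (hnc : X.NoInfiniteCrossing) (x : X.V) {U : Set X.H}
    (hU : X.MinUBS U) : ∃ o : X.H → Bool, Approx o ∧ (U \ diff o (ori x)).Finite := by
  obtain ⟨o, ho, h, -⟩ := exists_approx_of_faceOf hnc x hU hU hU.1 hU.1.faceOf_self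
    hU.1.faceOf_self
  exact ⟨o, ho, h⟩

lemma faceOf_diff {U : Set X.H} {o : X.H → Bool} {x : X.V} (hU : X.MinUBS U) (ho : Approx o)
    (hi : (U ∩ diff o (ori x)).Infinite) : X.FaceOf U (diff o (ori x)) :=
  have h := hU.inter_diff ho hi
  have hS := isUBS_diff ho (hi.mono Set.inter_subset_right)
  ⟨_, _, h.1, hS, h.2.1, .refl _, Set.inter_subset_right⟩

/-- Minimal UBSs met infinitely often towards a common orientation span a simplex. -/
lemma bAdj_or_almostEq {U V : Set X.H} {o : X.H → Bool} {x : X.V} (hU : X.MinUBS U)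
    (hV : X.MinUBS V) (ho : Approx o) (hiU : (U ∩ diff o (ori x)).Infinite)
    (hiV : (V ∩ diff o (ori x)).Infinite) : X.BAdj U V ∨ X.AlmostEq U V := by
  by_cases h : X.AlmostEq U V
  · exact Or.inr h
  · exact Or.inl ⟨hU, hV, h, _, isUBS_diff ho (hiU.mono Set.inter_subset_right),
      faceOf_diff hU ho hiU, faceOf_diff hV ho hiV⟩

/-! ### The two implications -/

lemma exists_btw_dist_eq_inter {o o' : X.H → Bool} (ho : Approx o) (ho' : Approx o') {x : X.V}
    {U : Set X.H} (hU : U.Infinite) (h : (U \ diff o (ori x)).Finite)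
    (h' : (U \ diff o' (ori x)).Finite) (r : ℕ) :
    ∃ q, Btw x q o ∧ Btw x q o' ∧ X.dist x q = r := by
  have hinf : (diff (maj (ori x) o o') (ori x)).Infinite := by
    rw [diff_maj]
    have h₁ := infinite_inter hU (B := diff o (ori x) ∩ diff o' (ori x)) (by
      rw [Set.sdiff_inter]; exact h.union h')
    exact h₁.mono Set.inter_subset_right
  obtain ⟨q, hq, hd⟩ := exists_btw_dist_eq (ho.maj x ho') hinf r
  refine ⟨q, fun k hk => ?_, fun k hk => ?_, hd⟩
  · have e : maj (ori x) o o' k = X.side k x := maj_of_eq_left (o₁ := ori x) hk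
    rw [← hk, ← e]; exact hq k e.symm
  · have e : maj (ori x) o o' k = X.side k x := maj_of_eq_mid (o₁ := ori x) hk
    rw [← hk, ← e]; exact hq k e.symm

lemma exists_avoidPathLen_of_chain (hnc : X.NoInfiniteCrossing) {x p : X.V} {r n : ℕ}
    {o : X.H → Bool} (ho : Approx o) (hp : Btw x p o) (hpr : X.dist x p = r)
    {c : ℕ → Set X.H} (hc : ∀ i ≤ n, X.MinUBS (c i))
    (hadj : ∀ i < n, X.BAdj (c i) (c (i + 1)) ∨ X.AlmostEq (c i) (c (i + 1)))
    (hco : (c 0 \ diff o (ori x)).Finite) {o' : X.H → Bool} (ho' : Approx o')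
    (hco' : (c n \ diff o' (ori x)).Finite) {q : X.V} (hq : Btw x q o') (hqr : X.dist x q = r) :
    ∃ l ≤ 2 * r * (n + 2), X.AvoidPathLen x r p q l := by
  induction n generalizing o' q with
  | zero =>
    obtain ⟨w, hw, hw', hd⟩ := exists_btw_dist_eq_inter ho ho' (hc 0 le_rfl).1.1 hco hco' r
    obtain ⟨l₁, hl₁, P₁⟩ := exists_avoidPathLen_of_btw ho hp hw hpr hd
    obtain ⟨l₂, hl₂, P₂⟩ := exists_avoidPathLen_of_btw ho' hw' hq hd hqr
    exact ⟨l₁ + l₂, by linarith, P₁.trans P₂⟩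
  | succ n ih =>
    obtain ⟨o₁, ho₁, h₁, h₂⟩ : ∃ o₁ : X.H → Bool, Approx o₁ ∧ (c n \ diff o₁ (ori x)).Finite ∧
        (c (n + 1) \ diff o₁ (ori x)).Finite := by
      rcases hadj n (Nat.lt_succ_self n) with ⟨hU, hV, -, W, hW, hUW, hVW⟩ | hae
      · exact exists_approx_of_faceOf hnc x hU hV hW hUW hVW
      · obtain ⟨o₁, ho₁, h₁⟩ := exists_approx_of_minUBS hnc x (hc n (Nat.le_succ n))
        exact ⟨o₁, ho₁, h₁, finite_sdiff_trans (AlmostEq.finite_sdiff (AlmostEq.symm hae)) h₁⟩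
    obtain ⟨w, hw, hw', hd⟩ :=
      exists_btw_dist_eq_inter ho₁ ho' (hc (n + 1) le_rfl).1.1 h₂ hco' r
    obtain ⟨l₁, hl₁, P₁⟩ := ih (fun i hi => hc i (by omega)) (fun i hi => hadj i (by omega))
      ho₁ h₁ hw hd
    obtain ⟨l₂, hl₂, P₂⟩ := exists_avoidPathLen_of_btw ho' hw' hq hd hqr
    exact ⟨l₁ + l₂, by linarith, P₁.trans P₂⟩

lemma exists_chain_of_bdist_le {U V : Set X.H} {D : ℕ} (h : X.bdist U V ≤ D) :
    ∃ n ≤ D, ∃ c : ℕ → Set X.H, X.AlmostEq (c 0) U ∧ X.AlmostEq (c n) V ∧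
      (∀ i ≤ n, X.MinUBS (c i)) ∧
      ∀ i < n, X.BAdj (c i) (c (i + 1)) ∨ X.AlmostEq (c i) (c (i + 1)) := by
  unfold bdist at h
  set S := {e : ℕ∞ | ∃ (n : ℕ) (c : ℕ → Set X.H),
    X.AlmostEq (c 0) U ∧ X.AlmostEq (c n) V ∧ (∀ i ≤ n, X.MinUBS (c i)) ∧
    (∀ i < n, X.BAdj (c i) (c (i+1)) ∨ X.AlmostEq (c i) (c (i+1))) ∧ e = n}
  have hne : S.Nonempty := by
    by_contra hc
    rw [Set.not_nonempty_iff_eq_empty] at hc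
    simp [hc] at h
  obtain ⟨n, c, h₀, hn, hm, ha, he⟩ := csInf_mem hne
  rw [he] at h
  exact ⟨n, by exact_mod_cast h, c, h₀, hn, hm, ha⟩

lemma linear_divergence_of_bounded (hnc : X.NoInfiniteCrossing) {D : ℕ}
    (hD : ∀ U V : Set X.H, X.MinUBS U → X.MinUBS V → X.bdist U V ≤ (D : ℕ∞)) {γ γ' : ℕ → X.V}
    (hγ : X.IsGeodesicRay γ) (hγ' : X.IsGeodesicRay γ') (h0 : γ' 0 = γ 0) (r : ℕ) :
    ∃ n ≤ 2 * r * (D + 2), X.AvoidPathLen (γ 0) r (γ r) (γ' r) n := by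
  obtain ⟨o, ho⟩ := exists_isLim γ
  obtain ⟨o', ho'⟩ := exists_isLim γ'
  obtain ⟨U, hUo, hU⟩ := exists_minUBS_subset hnc ho.approx (ho.infinite_diff_ray hγ)
  obtain ⟨V, hVo, hV⟩ := exists_minUBS_subset hnc ho'.approx (ho'.infinite_diff_ray hγ')
  obtain ⟨n, hn, c, hc0, hcn, hc, hadj⟩ := exists_chain_of_bdist_le (hD U V hU hV)
  have h₁ := (AlmostEq.finite_sdiff hc0).subset (Set.sdiff_subset_sdiff_right hUo)
  have h₂ := (AlmostEq.finite_sdiff hcn).subset (Set.sdiff_subset_sdiff_right hVo)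
  rw [h0] at h₂
  have hq : Btw (γ 0) (γ' r) o' := h0 ▸ ho'.btw_ray hγ' r
  have hqr : X.dist (γ 0) (γ' r) = r := h0 ▸ hγ' 0 r (Nat.zero_le _)
  obtain ⟨l, hl, P⟩ := exists_avoidPathLen_of_chain hnc ho.approx (ho.btw_ray hγ r)
    (hγ 0 r (Nat.zero_le _)) hc hadj h₁ ho'.approx h₂ hq hqr
  exact ⟨l, hl.trans (Nat.mul_le_mul_left _ (by omega)), P⟩

lemma dist_path_le {c : ℕ → X.V} {n : ℕ} (hc : ∀ i < n, X.Adj (c i) (c (i + 1))) {i j : ℕ}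
    (hij : i ≤ j) (hj : j ≤ n) : X.dist (c i) (c j) ≤ j - i := by
  induction j, hij using Nat.le_induction with
  | base => simp [dist_self]
  | succ j hij ih =>
    have h₁ := ih (by omega)
    have h₂ := dist_triangle (c i) (c j) (c (j + 1))
    rw [dist_of_adj (hc j (by omega))] at h₂
    omega

/-- The 0-cubes of a linear-length family of avoiding paths at evenly spaced times converge to
orientations, consecutive ones of which share infinitely many hyperplanes. -/
lemma infinite_inter_diff (hlf : X.LocallyFinite) (x : X.V) {z z' : ℕ → X.V} {o o' : X.H → Bool}
    (ho : IsLim z o) (ho' : IsLim z' o')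
    (hz : ∀ᶠ r in atTop, r ≤ X.dist x (z r) ∧ r ≤ X.dist x (z' r) ∧ X.dist (z r) (z' r) ≤ r) :
    (diff (maj (ori x) o o') (ori x)).Infinite := by
  choose m hm using fun n => exists_maj_vertex x (z n) (approx_ori (z' n))
  refine (IsLim.maj x ho ho' hm).infinite_diff hlf x ?_
  refine tendsto_atTop.2 fun b => ?_
  filter_upwards [hz, eventually_ge_atTop (2 * b)] with r hr hb
  have hbt₁ : Btw x (m r) (ori (z r)) := fun k hk => by
    rw [hm, ← hk]; exact maj_of_eq_left hk
  have hbt₂ : Btw x (m r) (ori (z' r)) := fun k hk => by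
    rw [hm, ← hk]; exact maj_of_eq_mid hk
  have hbt₃ : Btw (z r) (m r) (ori (z' r)) := fun k hk => by
    rw [hm, ← hk]; exact maj_of_eq_right hk
  have e₁ := hbt₁.dist_add
  have e₂ := hbt₂.dist_add
  have e₃ := hbt₃.dist_add
  rw [dist_comm (m r) (z r)] at e₁
  omega

lemma bdist_le_of_linear_divergence (hlf : X.LocallyFinite) (hnc : X.NoInfiniteCrossing)
    {A : ℝ} {N : ℕ} (hN : A + 1 ≤ N) (x : X.V)
    (hA : ∀ γ γ' : ℕ → X.V, X.IsGeodesicRay γ → X.IsGeodesicRay γ' → γ 0 = x → γ' 0 = x →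
      ∃ B : ℝ, ∀ r : ℕ, ∃ n : ℕ, X.AvoidPathLen x r (γ r) (γ' r) n ∧ (n : ℝ) ≤ A * r + B)
    {U V : Set X.H} (hU : X.MinUBS U) (hV : X.MinUBS V) : X.bdist U V ≤ ((N + 1 : ℕ) : ℕ∞) := by
  obtain ⟨oU, hoU, hfU⟩ := exists_approx_of_minUBS hnc x hU
  obtain ⟨oV, hoV, hfV⟩ := exists_approx_of_minUBS hnc x hV
  obtain ⟨γ, h0, hγ, hγU⟩ := exists_ray hoU x (infinite_inter hU.1.1 hfU) Set.inter_subset_right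
  obtain ⟨γ', h0', hγ', hγV⟩ :=
    exists_ray hoV x (infinite_inter hV.1.1 hfV) Set.inter_subset_right
  obtain ⟨B, hB⟩ := hA γ γ' hγ hγ' h0 h0'
  choose n hn hnB using hB
  choose c hc0 hcn hcadj hcr using hn
  have hnN : ∀ᶠ r in atTop, n r ≤ N * r := by
    filter_upwards [eventually_ge_atTop ⌈B⌉₊] with r hr
    have hBr : B ≤ r := (Nat.le_ceil B).trans (by exact_mod_cast hr)
    have h₁ : (n r : ℝ) ≤ N * r := by
      have := mul_le_mul_of_nonneg_right hN (Nat.cast_nonneg (α := ℝ) r)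
      have := hnB r
      linarith
    exact_mod_cast h₁
  let z : ℕ → ℕ → X.V := fun i r => c r (min (i * r) (n r))
  choose o ho using fun i => exists_isLim (z i)
  have hz : ∀ i r, r ≤ X.dist x (z i r) := fun i r => by
    rw [dist_comm]; exact hcr r _ (min_le_right _ _)
  have hinf : ∀ i, (diff (maj (ori x) (o i) (o (i + 1))) (ori x)).Infinite := fun i => by
    refine infinite_inter_diff hlf x (ho i) (ho (i + 1)) (Eventually.of_forall fun r =>
      ⟨hz _ _, hz _ _, ?_⟩)
    refine (dist_path_le (hcadj r) (min_le_min_right _ (Nat.mul_le_mul_right r i.le_succ))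
      (min_le_right _ _)).trans ?_
    rw [Nat.succ_mul]
    omega
  choose M hMo hM using fun i =>
    exists_minUBS_subset hnc ((ho i).approx.maj x (ho (i + 1)).approx) (hinf i)
  simp only [diff_maj] at hMo
  have hγlim : IsLim γ (o 0) := by
    have e : z 0 = γ := funext fun r => by simp [z, hc0]
    exact e ▸ ho 0
  have hγlim' : IsLim γ' (o N) := by
    intro h
    filter_upwards [ho N h, eventually_hyperfilter hnN] with r hr hr'
    rw [← hr]
    simp [z, hr', hcn]
  have hU0 : (U ∩ diff (o 0) (ori x)).Infinite := (hγU _ hγlim).mono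
    (Set.inter_subset_inter_left _ Set.inter_subset_left)
  have hVN : (V ∩ diff (o N) (ori x)).Infinite := (hγV _ hγlim').mono
    (Set.inter_subset_inter_left _ Set.inter_subset_left)
  have hMl : ∀ i, (M i ∩ diff (o i) (ori x)).Infinite := fun i =>
    (hM i).1.1.mono fun h hh => ⟨hh, (hMo i hh).1⟩
  have hMr : ∀ i, (M i ∩ diff (o (i + 1)) (ori x)).Infinite := fun i =>
    (hM i).1.1.mono fun h hh => ⟨hh, (hMo i hh).2⟩
  let d : ℕ → Set X.H := fun i => if i = N + 1 then V else if i = 0 then U else M (i - 1)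
  have hdU : ∀ i ≤ N, (d i ∩ diff (o i) (ori x)).Infinite := by
    intro i hi
    rcases i with _ | i
    · simpa [d] using hU0
    · simpa [d, show i ≠ N by omega] using hMr i
  have hdV : ∀ i ≤ N, (d (i + 1) ∩ diff (o i) (ori x)).Infinite := by
    intro i hi
    by_cases hiN : i = N
    · subst hiN; simpa [d] using hVN
    · simpa [d, hiN] using hMl i
  have hdm : ∀ i ≤ N + 1, X.MinUBS (d i) := by
    intro i _
    simp only [d]
    split_ifs
    exacts [hV, hU, hM _]
  refine sInf_le ⟨N + 1, d, ?_, ?_, hdm, fun i hi => ?_, rfl⟩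
  · simpa [d] using AlmostEq.refl U
  · simpa [d] using AlmostEq.refl V
  · exact bAdj_or_almostEq (hdm i (by omega)) (hdm _ (by omega)) (ho i).approx
      (hdU i (by omega)) (hdV i (by omega))

end CCC

/-- **Theorem C / Theorem 7.6** (linear divergence).  For a strongly locally
finite CAT(0) cube complex, the 1-skeleton of `∂X` has finite diameter iff
`X` has weakly uniformly linear divergence: there is `A` such that for every
basepoint `x₀` and every pair of combinatorial geodesic rays `γ, γ'` from
`x₀` there is `B` with `div_{γ,γ'}(r) ≤ A r + B` for all `r`. -/
theorem bounded_boundary_iff_linear_divergence (X : CCC)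
    (hlf : X.LocallyFinite) (hnc : X.NoInfiniteCrossing) :
    (∃ D : ℕ, ∀ U V : Set X.H, X.MinUBS U → X.MinUBS V → X.bdist U V ≤ (D : ℕ∞)) ↔
      (∃ A : ℝ, ∀ (x₀ : X.V) (γ γ' : ℕ → X.V),
        X.IsGeodesicRay γ → X.IsGeodesicRay γ' → γ 0 = x₀ → γ' 0 = x₀ →
        ∃ B : ℝ, ∀ r : ℕ, ∃ n : ℕ,
          X.AvoidPathLen x₀ r (γ r) (γ' r) n ∧ (n : ℝ) ≤ A * r + B) := by
  constructor
  · rintro ⟨D, hD⟩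
    refine ⟨2 * (D + 2), fun x₀ γ γ' hγ hγ' h0 h0' => ⟨0, fun r => ?_⟩⟩
    subst h0
    obtain ⟨n, hn, hp⟩ := CCC.linear_divergence_of_bounded hnc hD hγ hγ' h0' r
    refine ⟨n, hp, ?_⟩
    have : (n : ℝ) ≤ 2 * r * (D + 2) := by exact_mod_cast hn
    linarith
  · rintro ⟨A, hA⟩
    obtain ⟨x⟩ := X.nonempty_V
    exact ⟨⌈A + 1⌉₊ + 1, fun U V hU hV =>
      CCC.bdist_le_of_linear_divergence hlf hnc (Nat.le_ceil _) x (hA x) hU hV⟩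
end
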